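/- Let w ∈ ℂ∖{0}, let z ∈ ℂ with −1 < Re(z) < 1 and z ≠ 0, and let α > 0. Suppose F : ℂ × (0,∞) → ℂ is such that for each x > 0, s ↦ F(s,x) is holomorphic on {s : Re(s) > −1, s ≠ 1} and satisfies F(s,x) = ζ_w(s, x+1) for Re(s) > 1. Define φ_w(z,x) := F(z+1, x) + A_w(z)x^{−z−1}/2 − A_{iw}(−z)x^{−z}/z. Then α^{(z+1)/2}·(∑_{m=1}^∞ φ_w(z, mα) − ζ(z+1)A_w(z)/(2α^{z+1}) − ζ(z)A_w(−z)/(αz)) = (2^{z−1}π^{(z−3)/2}/Γ(z+1)) ∫_0^∞ Γ((z−1+it)/4)·Γ((z−1−it)/4)·Ξ((t+iz)/2)·Ξ((t−iz)/2)·Δ₂(α, z/2, w, (1+it)/2)/((z+1)² + t²) dt. -/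

import Mathlib

noncomputable section
open Complex MeasureTheory Set Filter Topology

/-- Pochhammer symbol `(a)_n`. -/
def poch (a : ℂ) (n : ℕ) : ℂ := (ascPochhammer ℂ n).eval a

/-- Confluent hypergeometric function `₁F₁(a; c; z)`. -/
def oneF1 (a c z : ℂ) : ℂ := ∑' n : ℕ, poch a n / poch c n * z ^ n / (n.factorial : ℂ)

/-- Complex error function, defined by integrating along the segment from `0` to `w`. -/
def cerf (w : ℂ) : ℂ :=
  (2 / (Real.sqrt Real.pi : ℂ)) * ∫ t in (0:ℝ)..1, w * Complex.exp (-(t * w) ^ 2)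

/-- Complex imaginary error function. -/
def cerfi (w : ℂ) : ℂ :=
  (2 / (Real.sqrt Real.pi : ℂ)) * ∫ t in (0:ℝ)..1, w * Complex.exp ((t * w) ^ 2)

/-- `A_w(z) = (√π/w) erf(w/2) ₁F₁(1 + z/2; 3/2; w²/4)`. -/
def Afun (w z : ℂ) : ℂ :=
  ((Real.sqrt Real.pi : ℂ) / w) * cerf (w / 2) * oneF1 (1 + z / 2) (3/2) (w ^ 2 / 4)

/-- The generalized Hurwitz zeta function `ζ_w(s, a)` (for `Re(s) > 1`, `a > 0`). -/
def zetaW (w s : ℂ) (a : ℝ) : ℂ :=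
  (4 / (w ^ 2 * (Real.sqrt Real.pi : ℂ) * Complex.Gamma ((s + 1) / 2))) *
    ∑' n : ℕ+, ∫ u in Ioi (0:ℝ), ∫ v in Ioi (0:ℝ),
      ((u * v : ℝ) : ℂ) ^ (s - 1) * Complex.exp (-((u:ℂ) ^ 2 + (v:ℂ) ^ 2)) *
        Complex.sin (w * v) * Complex.sinh (w * u) /
        (((n:ℂ) ^ 2 * (u:ℂ) ^ 2 + ((a:ℂ) - 1) ^ 2 * (v:ℂ) ^ 2)) ^ (s / 2)

/-- `ω(x, z, w, s)`. -/
def omegaFun (x : ℝ) (z w s : ℂ) : ℂ :=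
  Complex.exp (w ^ 2 / 4) * (x:ℂ) ^ ((1:ℂ)/2 - s) *
    oneF1 (1 - (s + z) / 2) (3/2) (-w ^ 2 / 4) * oneF1 (1 - (s - z) / 2) (3/2) (-w ^ 2 / 4)

/-- `Δ₂(x, z, w, s) = ω(x, z, w, s) + ω(x, z, w, 1 - s)`. -/
def Delta2 (x : ℝ) (z w s : ℂ) : ℂ := omegaFun x z w s + omegaFun x z w (1 - s)


/-- The Riemann xi function. -/
def RiemannXi (s : ℂ) : ℂ :=
  (1/2) * s * (s - 1) * (Real.pi : ℂ) ^ (-s / 2) * Complex.Gamma (s / 2) * riemannZeta s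

/-- The Riemann Xi function `Ξ(t) = ξ(1/2 + it)`. -/
def RiemannBigXi (t : ℂ) : ℂ := RiemannXi (1 / 2 + I * t)

/-- power bound on the half line -/
def PB (f : ℝ → ℂ) (a : ℝ) : Prop := ∃ C : ℝ, 0 ≤ C ∧ ∀ y : ℝ, 0 < y → ‖f y‖ ≤ C * y ^ (-a)

lemma PB.mul {f g : ℝ → ℂ} {a b : ℝ} (hf : PB f a) (hg : PB g b) :
    PB (fun y => f y * g y) (a + b) := by
  obtain ⟨C, hC, hf⟩ := hf
  obtain ⟨D, hD, hg⟩ := hg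
  refine ⟨C * D, mul_nonneg hC hD, fun y hy => ?_⟩
  rw [norm_mul, neg_add, Real.rpow_add hy]
  calc ‖f y‖ * ‖g y‖ ≤ (C * y ^ (-a)) * (D * y ^ (-b)) := by
        gcongr
        · exact hf y hy
        · exact hg y hy
    _ = _ := by ring

lemma PB.add {f g : ℝ → ℂ} {a : ℝ} (hf : PB f a) (hg : PB g a) :
    PB (fun y => f y + g y) a := by
  obtain ⟨C, hC, hf⟩ := hf
  obtain ⟨D, hD, hg⟩ := hg
  refine ⟨C + D, by positivity, fun y hy => ?_⟩
  refine (norm_add_le _ _).trans ?_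
  linarith [hf y hy, hg y hy]

lemma PB.const_mul {f : ℝ → ℂ} {a : ℝ} (hf : PB f a) (c : ℂ) :
    PB (fun y => c * f y) a := by
  obtain ⟨C, hC, hf⟩ := hf
  refine ⟨‖c‖ * C, by positivity, fun y hy => ?_⟩
  rw [norm_mul, mul_assoc]
  exact mul_le_mul_of_nonneg_left (hf y hy) (norm_nonneg _)

lemma PB.sub {f g : ℝ → ℂ} {a : ℝ} (hf : PB f a) (hg : PB g a) :
    PB (fun y => f y - g y) a := by
  have := hf.add (hg.const_mul (-1))
  simpa [sub_eq_add_neg] using this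

lemma PB.interp {f : ℝ → ℂ} {a b c : ℝ} (hf : PB f a) (hg : PB f b) (h1 : a ≤ c) (h2 : c ≤ b) :
    PB f c := by
  obtain ⟨C, hC, hf⟩ := hf
  obtain ⟨D, hD, hg⟩ := hg
  refine ⟨C + D, by positivity, fun y hy => ?_⟩
  have hp := Real.rpow_nonneg hy.le (-c)
  rcases le_total y 1 with h | h
  · have : y ^ (-a) ≤ y ^ (-c) := Real.rpow_le_rpow_of_exponent_ge hy h (by linarith)
    have := mul_le_mul_of_nonneg_left this hC
    nlinarith [hf y hy, mul_nonneg hD hp]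
  · have : y ^ (-b) ≤ y ^ (-c) := Real.rpow_le_rpow_of_exponent_le h (by linarith)
    have := mul_le_mul_of_nonneg_left this hD
    nlinarith [hg y hy, mul_nonneg hC hp]

lemma PB.comp_mul {f : ℝ → ℂ} {a : ℝ} (hf : PB f a) {k : ℝ} (hk : 0 < k) :
    PB (fun y => f (k * y)) a := by
  obtain ⟨C, hC, hf⟩ := hf
  refine ⟨C * k ^ (-a), by positivity, fun y hy => ?_⟩
  refine (hf _ (by positivity)).trans (le_of_eq ?_)
  rw [Real.mul_rpow hk.le hy.le, mul_assoc]

lemma PB.top {f : ℝ → ℂ} {a : ℝ} (hf : PB f a) : f =O[atTop] (fun y : ℝ => y ^ (-a)) := by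
  obtain ⟨C, hC, hf⟩ := hf
  refine Asymptotics.IsBigO.of_bound C ?_
  filter_upwards [eventually_gt_atTop 0] with y hy
  rw [Real.norm_of_nonneg (Real.rpow_nonneg hy.le _)]
  exact hf y hy

lemma PB.bot {f : ℝ → ℂ} {a : ℝ} (hf : PB f a) : f =O[𝓝[>] 0] (fun y : ℝ => y ^ (-a)) := by
  obtain ⟨C, hC, hf⟩ := hf
  refine Asymptotics.IsBigO.of_bound C ?_
  filter_upwards [self_mem_nhdsWithin] with y hy
  rw [Real.norm_of_nonneg (Real.rpow_nonneg (le_of_lt hy) _)]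
  exact hf y hy

lemma PB.mellinConvergent {f : ℝ → ℂ} {a b : ℝ} (hc : ContinuousOn f (Ioi 0)) (hf : PB f a)
    (hg : PB f b) {s : ℂ} (h1 : b < s.re) (h2 : s.re < a) : MellinConvergent f s :=
  mellinConvergent_of_isBigO_rpow (hc.locallyIntegrableOn measurableSet_Ioi) hf.top h2 hg.bot h1

lemma PB.mellinDiff {f : ℝ → ℂ} {a b : ℝ} (hc : ContinuousOn f (Ioi 0)) (hf : PB f a)
    (hg : PB f b) {s : ℂ} (h1 : b < s.re) (h2 : s.re < a) : DifferentiableAt ℂ (mellin f) s :=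
  mellin_differentiableAt_of_isBigO_rpow (hc.locallyIntegrableOn measurableSet_Ioi) hf.top h2
    hg.bot h1

/-- nice functions: smooth decay and vanishing at zero -/
def Nice (f : ℝ → ℂ) : Prop := ContinuousOn f (Ioi 0) ∧ ∀ a : ℝ, -1 ≤ a → PB f a

lemma Nice.mellinConvergent {f : ℝ → ℂ} (hf : Nice f) {s : ℂ} (hs : -1 < s.re) :
    MellinConvergent f s :=
  PB.mellinConvergent hf.1 (hf.2 (s.re + 1) (by linarith)) (hf.2 (-1) le_rfl) hs (by linarith)

lemma Nice.mellinDiff {f : ℝ → ℂ} (hf : Nice f) {s : ℂ} (hs : -1 < s.re) :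
    DifferentiableAt ℂ (mellin f) s :=
  PB.mellinDiff hf.1 (hf.2 (s.re + 1) (by linarith)) (hf.2 (-1) le_rfl) hs (by linarith)

lemma Nice.const_mul {f : ℝ → ℂ} (hf : Nice f) (c : ℂ) : Nice (fun u => c * f u) :=
  ⟨continuousOn_const.mul hf.1, fun a ha => (hf.2 a ha).const_mul c⟩

lemma norm_ofReal_cpow_pos {y : ℝ} (hy : 0 < y) (s : ℂ) : ‖(y : ℂ) ^ s‖ = y ^ s.re :=
  Complex.norm_cpow_eq_rpow_re_of_pos hy s

/-- absolute integrability -/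
lemma MellinConvergent.norm' {f : ℝ → ℂ} {s : ℂ} (h : MellinConvergent f s) :
    IntegrableOn (fun u : ℝ => u ^ (s.re - 1) * ‖f u‖) (Ioi 0) := by
  have := h.norm
  refine (integrableOn_congr_fun ?_ measurableSet_Ioi).mp this
  intro u hu
  simp only [norm_smul]
  rw [norm_ofReal_cpow_pos hu]
  simp

lemma Nice.absInt {f : ℝ → ℂ} (hf : Nice f) {a : ℝ} (ha : -1 < a) :
    IntegrableOn (fun u : ℝ => u ^ (a - 1) * ‖f u‖) (Ioi 0) := by
  have := (hf.mellinConvergent (s := (a : ℂ)) (by simpa using ha)).norm'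
  simpa using this

/-- multiplicative convolution -/
def cv (f N : ℝ → ℂ) (r : ℝ) : ℂ := ∫ u in Ioi (0:ℝ), f u * N (r / u) / u

lemma cv_dom {f N : ℝ → ℂ} {a C : ℝ} (hN : ∀ y, 0 < y → ‖N y‖ ≤ C * y ^ (-a)) {r : ℝ}
    (hr : 0 < r) {u : ℝ} (hu : 0 < u) :
    ‖f u * N (r / u) / u‖ ≤ (C * r ^ (-a)) * (u ^ (a - 1) * ‖f u‖) := by
  have hu' : (0:ℝ) < u := hu
  rw [norm_div, norm_mul]
  have h1 := hN (r / u) (by positivity)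
  have h2 : ‖(u:ℂ)‖ = u := by simp [abs_of_pos hu']
  rw [h2, div_le_iff₀ hu']
  have h3 : u ^ (a - 1) * u = u ^ a := by
    rw [Real.rpow_sub_one hu'.ne']; field_simp
  have h4 : (r / u) ^ (-a) = r ^ (-a) * u ^ a := by
    rw [Real.div_rpow hr.le hu'.le, Real.rpow_neg hu'.le]; field_simp
  rw [h4] at h1
  calc ‖f u‖ * ‖N (r / u)‖ ≤ ‖f u‖ * (C * (r ^ (-a) * u ^ a)) := by gcongr
    _ = C * r ^ (-a) * ((u ^ (a - 1) * u) * ‖f u‖) := by rw [h3]; ring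
    _ = _ := by ring

lemma cv_contOn_integrand {f N : ℝ → ℂ} (hf : ContinuousOn f (Ioi 0)) (hN : ContinuousOn N (Ioi 0))
    {r : ℝ} (hr : 0 < r) : ContinuousOn (fun u : ℝ => f u * N (r / u) / u) (Ioi 0) := by
  refine ContinuousOn.div (hf.mul ?_) (by fun_prop) ?_
  · refine hN.comp (ContinuousOn.div continuousOn_const continuousOn_id ?_) ?_
    · intro u hu; exact (ne_of_gt hu)
    · intro u hu; exact div_pos hr hu
  · intro u hu; simpa using (ne_of_gt hu)

lemma cv_integrable {f N : ℝ → ℂ} (hf : Nice f) (hNc : ContinuousOn N (Ioi 0)) {a : ℝ}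
    (ha : -1 < a) (hN : PB N a) {r : ℝ} (hr : 0 < r) :
    IntegrableOn (fun u : ℝ => f u * N (r / u) / u) (Ioi 0) := by
  obtain ⟨C, hC, hN⟩ := hN
  refine ((hf.absInt ha).const_mul (C * r ^ (-a))).mono'
    ((cv_contOn_integrand hf.1 hNc hr).aestronglyMeasurable measurableSet_Ioi) ?_
  filter_upwards [ae_restrict_mem measurableSet_Ioi] with u hu
  exact cv_dom hN hr hu

lemma PB.cv {f N : ℝ → ℂ} (hf : Nice f) {a : ℝ} (ha : -1 < a) (hN : PB N a) : PB (cv f N) a := by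
  obtain ⟨C, hC, hN⟩ := hN
  refine ⟨C * ∫ u in Ioi (0:ℝ), u ^ (a - 1) * ‖f u‖, ?_, fun r hr => ?_⟩
  · refine mul_nonneg hC (setIntegral_nonneg measurableSet_Ioi fun u hu => ?_)
    exact mul_nonneg (Real.rpow_nonneg (le_of_lt hu) _) (norm_nonneg _)
  · have := norm_integral_le_of_norm_le ((hf.absInt ha).const_mul (C * r ^ (-a)))
      (f := fun u : ℝ => f u * N (r / u) / u) ?_
    · rw [integral_const_mul] at this
      refine this.trans (le_of_eq (by ring))
    · filter_upwards [ae_restrict_mem measurableSet_Ioi] with u hu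
      exact cv_dom hN hr hu

lemma cv_continuousOn {f N : ℝ → ℂ} (hf : Nice f) (hNc : ContinuousOn N (Ioi 0)) (hN : PB N 0) :
    ContinuousOn (cv f N) (Ioi 0) := by
  obtain ⟨C, hC, hN⟩ := hN
  intro r0 hr0
  refine ContinuousAt.continuousWithinAt ?_
  refine continuousAt_of_dominated (bound := fun u => C * (u ^ ((0:ℝ) - 1) * ‖f u‖)) ?_ ?_ ?_ ?_
  · filter_upwards [Ioi_mem_nhds hr0] with r hr
    exact (cv_contOn_integrand hf.1 hNc hr).aestronglyMeasurable measurableSet_Ioi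
  · filter_upwards [Ioi_mem_nhds hr0] with r hr
    filter_upwards [ae_restrict_mem measurableSet_Ioi] with u hu
    have := cv_dom (f := f) hN hr hu
    simpa using this
  · exact (hf.absInt (by norm_num)).const_mul C
  · filter_upwards [ae_restrict_mem measurableSet_Ioi] with u hu
    refine ContinuousAt.div_const (continuousAt_const.mul ?_) _
    have h : ContinuousAt N (r0 / u) := hNc.continuousAt (Ioi_mem_nhds (div_pos hr0 hu))
    exact ContinuousAt.comp (f := fun r : ℝ => r / u) h (by fun_prop)

lemma cv_comp_mul (f N : ℝ → ℂ) (k r : ℝ) : cv f (fun y => N (k * y)) r = cv f N (k * r) := by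
  unfold cv
  congr 1; ext u
  change f u * N (k * (r / u)) / u = _
  rw [mul_div_assoc k]

theorem hasMellin_cv {f N : ℝ → ℂ} (hfc : ContinuousOn f (Ioi 0)) (hNc : ContinuousOn N (Ioi 0))
    {p : ℂ} (hf : MellinConvergent f p) (hN : MellinConvergent N p) :
    HasMellin (cv f N) p (mellin f p * mellin N p) := by
  set μ : Measure ℝ := volume.restrict (Ioi (0:ℝ)) with hμ
  set h : ℝ × ℝ → ℂ := fun q => (q.2 : ℂ) ^ (p - 1) * (f q.1 * N (q.2 / q.1) / q.1) with hh
  have hcont : ContinuousOn h (Ioi 0 ×ˢ Ioi 0) := by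
    intro q hq
    have hq1 : 0 < q.1 := hq.1
    have hq2 : 0 < q.2 := hq.2
    refine ContinuousAt.continuousWithinAt ?_
    have e1 : ContinuousAt (fun q : ℝ × ℝ => (q.2 : ℂ) ^ (p - 1)) q :=
      ContinuousAt.comp (f := fun q : ℝ × ℝ => q.2) (g := fun x : ℝ => (x:ℂ) ^ (p - 1))
        (continuousAt_ofReal_cpow_const _ _ (Or.inr hq2.ne')) continuous_snd.continuousAt
    have e2 : ContinuousAt (fun q : ℝ × ℝ => f q.1) q :=
      ContinuousAt.comp (f := fun q : ℝ × ℝ => q.1) (hfc.continuousAt (Ioi_mem_nhds hq1))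
        continuous_fst.continuousAt
    have e3 : ContinuousAt (fun q : ℝ × ℝ => N (q.2 / q.1)) q :=
      ContinuousAt.comp (f := fun q : ℝ × ℝ => q.2 / q.1)
        (hNc.continuousAt (Ioi_mem_nhds (div_pos hq2 hq1)))
        (continuous_snd.continuousAt.div continuous_fst.continuousAt hq1.ne')
    refine e1.mul ((e2.mul e3).div (by fun_prop) ?_)
    simpa using hq1.ne'
  have hmeas : AEStronglyMeasurable h (μ.prod μ) := by
    rw [hμ, Measure.prod_restrict]
    exact hcont.aestronglyMeasurable (measurableSet_Ioi.prod measurableSet_Ioi)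
  have hker : ∀ u : ℝ, 0 < u → (fun r : ℝ => h (u, r)) =
      fun r : ℝ => (f u / u) * ((r:ℂ) ^ (p - 1) • N (u⁻¹ * r)) := by
    intro u hu
    ext r
    simp only [hh, smul_eq_mul]
    rw [div_eq_inv_mul r u]; ring
  have hIntg : Integrable h (μ.prod μ) := by
    rw [integrable_prod_iff hmeas]
    constructor
    · filter_upwards [ae_restrict_mem measurableSet_Ioi] with u hu
      rw [hker u hu]
      exact ((MellinConvergent.comp_mul_left (inv_pos.mpr hu)).mpr hN).const_mul _
    · have key : ∀ u : ℝ, 0 < u → ∫ r, ‖h (u, r)‖ ∂μ =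
          (∫ r in Ioi (0:ℝ), ‖(r:ℂ) ^ (p - 1) • N r‖) * ‖(u:ℂ) ^ (p - 1) • f u‖ := by
        intro u hu
        have e1 : ∀ r ∈ Ioi (0:ℝ), ‖h (u, r)‖ = (‖f u‖ / u * u ^ (p.re - 1)) *
            (fun r : ℝ => ‖(r:ℂ) ^ (p - 1) • N r‖) (u⁻¹ * r) := by
          intro r hr
          have hr' : 0 < r := hr
          have e0 : h (u, r) = (f u / u) * ((r:ℂ) ^ (p - 1) • N (u⁻¹ * r)) :=
            congrFun (hker u hu) r
          rw [e0, norm_mul, norm_smul, norm_div]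
          simp only [norm_smul]
          rw [norm_ofReal_cpow_pos hr', norm_ofReal_cpow_pos (by positivity),
            Real.mul_rpow (by positivity) hr'.le, Real.inv_rpow hu.le, Complex.norm_real,
            Real.norm_of_nonneg hu.le]
          have : u ^ (p - 1).re ≠ 0 := (Real.rpow_pos_of_pos hu _).ne'
          have e2 : (p - 1).re = p.re - 1 := by simp
          rw [e2] at this ⊢
          field_simp
        rw [hμ, setIntegral_congr_fun measurableSet_Ioi e1, integral_const_mul,
          integral_comp_mul_left_Ioi (fun r : ℝ => ‖(r:ℂ) ^ (p - 1) • N r‖) 0 (inv_pos.mpr hu)]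
        rw [norm_smul (_ ^ _) (f u), norm_ofReal_cpow_pos hu]
        simp only [mul_zero, inv_inv, smul_eq_mul, sub_re, one_re]
        field_simp
      refine (hf.norm.const_mul (∫ r in Ioi (0:ℝ), ‖(r:ℂ) ^ (p - 1) • N r‖)).congr ?_
      filter_upwards [ae_restrict_mem measurableSet_Ioi] with u hu
      exact (key u hu).symm
  have hr : ∀ r : ℝ, ∫ u, h (u, r) ∂μ = (r:ℂ) ^ (p - 1) • cv f N r := by
    intro r
    simp only [hh, cv, smul_eq_mul]
    rw [integral_const_mul]
  constructor
  · have := hIntg.integral_prod_right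
    refine this.congr (Eventually.of_forall fun r => ?_)
    exact hr r
  · have e1 : mellin (cv f N) p = ∫ r, ∫ u, h (u, r) ∂μ ∂μ := by
      rw [mellin]
      exact integral_congr_ae (Eventually.of_forall fun r => (hr r).symm)
    rw [e1, ← integral_integral_swap (f := fun u r => h (u, r)) hIntg]
    have e2 : ∀ u ∈ Ioi (0:ℝ), ∫ r, h (u, r) ∂μ = ((u:ℂ) ^ (p - 1) • f u) * mellin N p := by
      intro u hu
      have hu' : (0:ℝ) < u := hu
      have hu0 : (u:ℂ) ≠ 0 := by exact_mod_cast hu'.ne'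
      rw [hker u hu, integral_const_mul]
      have := mellin_comp_mul_left N p (inv_pos.mpr hu')
      rw [mellin] at this
      rw [this, smul_eq_mul, smul_eq_mul, Complex.ofReal_inv, Complex.inv_cpow _ _ ?_,
        Complex.cpow_neg, inv_inv, Complex.cpow_sub _ _ hu0, Complex.cpow_one]
      · ring
      · rw [Complex.arg_ofReal_of_nonneg hu'.le]; exact Real.pi_pos.ne
    rw [hμ, setIntegral_congr_fun measurableSet_Ioi e2, integral_mul_const]
    rfl

lemma rpow_exp_bound {b : ℝ} (hb : 0 ≤ b) :
    ∃ C : ℝ, 0 ≤ C ∧ ∀ y : ℝ, 0 < y → y ^ b * Real.exp (-y) ≤ C := by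
  obtain ⟨n, hn⟩ := exists_nat_ge b
  refine ⟨1 + n.factorial, by positivity, fun y hy => ?_⟩
  rw [Real.exp_neg, ← div_eq_mul_inv, div_le_iff₀ (Real.exp_pos y)]
  have h1 : y ^ b ≤ 1 + y ^ n := by
    rcases le_total y 1 with h | h
    · have := Real.rpow_le_one hy.le h hb
      have : (0:ℝ) ≤ y ^ n := by positivity
      linarith
    · have : y ^ b ≤ y ^ (n:ℝ) := Real.rpow_le_rpow_of_exponent_le h hn
      rw [Real.rpow_natCast] at this
      linarith
  have h2 := Real.pow_div_factorial_le_exp y hy.le n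
  rw [div_le_iff₀ (by positivity)] at h2
  have h3 := Real.one_le_exp hy.le
  nlinarith

def gs (y : ℝ) : ℂ := ((Real.exp (-y ^ 2) : ℝ) : ℂ)

lemma gs_cont : Continuous gs := by unfold gs; fun_prop

lemma gs_norm (y : ℝ) : ‖gs y‖ = Real.exp (-y ^ 2) := by
  rw [gs, Complex.norm_real, Real.norm_of_nonneg (Real.exp_pos _).le]

lemma gs_PB {a : ℝ} (ha : 0 ≤ a) : PB gs a := by
  obtain ⟨C, hC, h⟩ := rpow_exp_bound ha
  refine ⟨C * Real.exp 1, by positivity, fun y hy => ?_⟩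
  rw [gs_norm, Real.rpow_neg hy.le, ← div_eq_mul_inv, le_div_iff₀ (Real.rpow_pos_of_pos hy a)]
  have h1 : Real.exp (-y ^ 2) ≤ Real.exp (-y) * Real.exp 1 := by
    rw [← Real.exp_add]
    apply Real.exp_le_exp.mpr
    nlinarith [sq_nonneg (y - 1), sq_nonneg y]
  have h2 := h y hy
  have h3 := Real.rpow_nonneg hy.le a
  calc Real.exp (-y ^ 2) * y ^ a ≤ (Real.exp (-y) * Real.exp 1) * y ^ a := by gcongr
    _ = (y ^ a * Real.exp (-y)) * Real.exp 1 := by ring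
    _ ≤ _ := by gcongr

lemma pnat_summable {a : ℝ} (ha : 1 < a) : Summable (fun k : ℕ+ => ((k:ℝ)) ^ (-a)) := by
  have := (Real.summable_nat_rpow (p := -a)).mpr (by linarith)
  exact this.comp_injective PNat.coe_injective

lemma exp_le_inv_sq {x : ℝ} (hx : x ≠ 0) : Real.exp (-x ^ 2) ≤ 1 / x ^ 2 := by
  have h0 : 0 < x ^ 2 := by positivity
  rw [Real.exp_neg, ← one_div]
  apply one_div_le_one_div_of_le h0
  linarith [Real.add_one_le_exp (x ^ 2)]

lemma pnat_sq_summable : Summable (fun k : ℕ+ => 1 / ((k:ℝ)) ^ 2) := by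
  have := (Real.summable_one_div_nat_pow (p := 2)).mpr (by norm_num)
  exact this.comp_injective PNat.coe_injective

def psiR (y : ℝ) : ℝ := ∑' n : ℕ+, Real.exp (-((n:ℝ) * y) ^ 2)

lemma psiR_term {y : ℝ} (hy : 0 < y) (n : ℕ+) :
    Real.exp (-((n:ℝ) * y) ^ 2) ≤ (1 / (n:ℝ) ^ 2) * (1 / y ^ 2) := by
  have hn : (0:ℝ) < n := by exact_mod_cast n.pos
  refine (exp_le_inv_sq (by positivity)).trans (le_of_eq ?_)
  field_simp

lemma psiR_summable {y : ℝ} (hy : 0 < y) :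
    Summable (fun n : ℕ+ => Real.exp (-((n:ℝ) * y) ^ 2)) :=
  Summable.of_nonneg_of_le (fun _ => (Real.exp_pos _).le) (psiR_term hy)
    (pnat_sq_summable.mul_right _)

lemma psiR_nonneg (y : ℝ) : 0 ≤ psiR y := tsum_nonneg fun _ => (Real.exp_pos _).le

def ZZ : ℝ := ∑' n : ℕ+, 1 / (n:ℝ) ^ 2
lemma ZZ_nonneg : 0 ≤ ZZ := tsum_nonneg fun _ => by positivity

lemma psiR_le {y : ℝ} (hy : 0 < y) : psiR y ≤ ZZ / y ^ 2 := by
  have := (psiR_summable hy).tsum_le_tsum (psiR_term hy) (pnat_sq_summable.mul_right _)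
  rw [tsum_mul_right] at this
  rw [psiR, ZZ]
  exact this.trans (le_of_eq (by ring))

lemma psiR_cont : ContinuousOn psiR (Ioi 0) := by
  intro y0 hy0
  have hy0' : (0:ℝ) < y0 := hy0
  have : ContinuousOn psiR (Ioi (y0 / 2)) := by
    unfold psiR
    refine continuousOn_tsum (u := fun n : ℕ+ => (1 / (n:ℝ) ^ 2) * (1 / (y0 / 2) ^ 2)) ?_
      (pnat_sq_summable.mul_right _) ?_
    · intro i; fun_prop
    · intro n y hy
      have hy1 : y0 / 2 < y := hy
      rw [Real.norm_of_nonneg (Real.exp_pos _).le]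
      refine (psiR_term (by linarith) n).trans ?_
      gcongr
  exact (this.continuousAt (Ioi_mem_nhds (by linarith))).continuousWithinAt

def TR (y : ℝ) : ℝ := psiR y + 1 / 2 - Real.sqrt Real.pi / (2 * y)

lemma sum_int_eq {c : ℝ} (hc : 0 < c) :
    ∑' n : ℤ, Real.exp (-(c * n) ^ 2) = 1 + 2 * psiR c := by
  have hs : Summable (fun n : ℤ => Real.exp (-(c * n) ^ 2)) := by
    have h := summable_pow_mul_jacobiTheta₂_term_bound 0 (T := c ^ 2 / Real.pi) (by positivity) 0
    refine h.congr fun n => ?_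
    simp only [pow_zero, one_mul, mul_zero, zero_mul, sub_zero]
    congr 1
    field_simp
  rw [tsum_int_eq_zero_add_two_mul_tsum_pnat (fun n => by simp) hs]
  simp [psiR, mul_comm]

lemma TR_eq {y : ℝ} (hy : 0 < y) :
    TR y = Real.sqrt Real.pi / y * psiR (Real.pi / y) := by
  have hpi := Real.pi_pos
  have h := Real.tsum_exp_neg_mul_int_sq (a := y ^ 2 / Real.pi) (by positivity)
  have e1 : ∀ n : ℤ, Real.exp (-Real.pi * (y ^ 2 / Real.pi) * (n:ℝ) ^ 2) =
      Real.exp (-(y * n) ^ 2) := by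
    intro n; congr 1; field_simp
  have e2 : ∀ n : ℤ, Real.exp (-Real.pi / (y ^ 2 / Real.pi) * (n:ℝ) ^ 2) =
      Real.exp (-((Real.pi / y) * n) ^ 2) := by
    intro n; congr 1; field_simp
  simp_rw [e1, e2] at h
  rw [sum_int_eq hy, sum_int_eq (by positivity), ← Real.sqrt_eq_rpow, Real.sqrt_div (by positivity),
    Real.sqrt_sq hy.le] at h
  rw [TR]
  have hsp : 0 < Real.sqrt Real.pi := Real.sqrt_pos.mpr hpi
  field_simp at h ⊢
  linarith

def psi (y : ℝ) : ℂ := (psiR y : ℂ)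
def TT (y : ℝ) : ℂ := (TR y : ℂ)
def EE (y : ℝ) : ℂ := TT y - 1 / 2

lemma psi_eq {y : ℝ} : psi y = TT y - 1 / 2 + (Real.sqrt Real.pi / 2 : ℂ) * (y : ℂ)⁻¹ := by
  rw [psi, TT, TR]; push_cast
  rw [div_mul_eq_div_div]; ring

lemma EE_eq {y : ℝ} : EE y = psi y - (Real.sqrt Real.pi / 2 : ℂ) * (y : ℂ)⁻¹ := by
  rw [psi_eq, EE]; ring

lemma psi_cont : ContinuousOn psi (Ioi 0) :=
  Complex.continuous_ofReal.comp_continuousOn psiR_cont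

lemma TT_cont : ContinuousOn TT (Ioi 0) := by
  refine Complex.continuous_ofReal.comp_continuousOn ?_
  unfold TR
  refine (psiR_cont.add continuousOn_const).sub (ContinuousOn.div continuousOn_const (by fun_prop) ?_)
  intro y hy
  have : (0:ℝ) < y := hy
  positivity

lemma EE_cont : ContinuousOn EE (Ioi 0) := TT_cont.sub continuousOn_const

lemma psi_PB2 : PB psi 2 := by
  refine ⟨ZZ, ZZ_nonneg, fun y hy => ?_⟩
  rw [psi, Complex.norm_real, Real.norm_of_nonneg (psiR_nonneg _), Real.rpow_neg hy.le]
  have := psiR_le hy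
  rw [div_eq_mul_inv] at this
  exact_mod_cast this

lemma const_PB (c : ℂ) : PB (fun _ => c) 0 := ⟨‖c‖, norm_nonneg _, fun y _ => by simp⟩

lemma inv_PB : PB (fun y => (y:ℂ)⁻¹) 1 := ⟨1, zero_le_one, fun y hy => by
  rw [norm_inv, Complex.norm_real, Real.norm_of_nonneg hy.le, Real.rpow_neg_one, one_mul]⟩

lemma TT_PBm1 : PB TT (-1) := by
  have hpi := Real.pi_pos
  refine ⟨Real.sqrt Real.pi * ZZ / Real.pi ^ 2, by have := ZZ_nonneg; positivity, fun y hy => ?_⟩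
  have h1 := psiR_le (y := Real.pi / y) (by positivity)
  have h0 := psiR_nonneg (Real.pi / y)
  rw [TT, TR_eq hy, Complex.norm_real, Real.norm_of_nonneg (by positivity), neg_neg, Real.rpow_one]
  calc Real.sqrt Real.pi / y * psiR (Real.pi / y)
      ≤ Real.sqrt Real.pi / y * (ZZ / (Real.pi / y) ^ 2) := by gcongr
    _ = _ := by field_simp

lemma TT_PB0 : PB TT 0 := by
  obtain ⟨C, hC, h1⟩ := TT_PBm1
  obtain ⟨D, hD, h2⟩ := psi_PB2
  refine ⟨C + D + 1 / 2 + Real.sqrt Real.pi / 2, by positivity, fun y hy => ?_⟩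
  have hsp : 0 ≤ Real.sqrt Real.pi := Real.sqrt_nonneg _
  rw [neg_zero, Real.rpow_zero, mul_one]
  rcases le_total y 1 with h | h
  · have := h1 y hy
    rw [neg_neg, Real.rpow_one] at this
    nlinarith
  · have h3 := h2 y hy
    have e : TT y = psi y + 1 / 2 - (Real.sqrt Real.pi / 2 : ℂ) * (y : ℂ)⁻¹ := by rw [psi_eq]; ring
    have e2 : y ^ (-(2:ℝ)) ≤ 1 := Real.rpow_le_one_of_one_le_of_nonpos h (by norm_num)
    have e3 : ‖(Real.sqrt Real.pi / 2 : ℂ) * (y : ℂ)⁻¹‖ ≤ Real.sqrt Real.pi / 2 := by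
      rw [norm_mul, norm_div, norm_inv, Complex.norm_real, Complex.norm_real,
        Real.norm_of_nonneg hsp, Real.norm_of_nonneg hy.le, RCLike.norm_ofNat]
      have : y⁻¹ ≤ 1 := inv_le_one_of_one_le₀ h
      nlinarith
    have e4 : ‖psi y‖ ≤ D := by nlinarith
    have e5 : ‖(1/2 : ℂ)‖ = 1 / 2 := by norm_num
    rw [e]
    refine (norm_sub_le _ _).trans ?_
    have := norm_add_le (psi y) (1/2)
    linarith

lemma TT_PB {a : ℝ} (h1 : -1 ≤ a) (h2 : a ≤ 0) : PB TT a := TT_PBm1.interp TT_PB0 h1 h2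

lemma psi_PB1 : PB psi 1 := by
  obtain ⟨C, hC, h1⟩ := TT_PB0
  obtain ⟨D, hD, h2⟩ := psi_PB2
  refine ⟨C + D + 1 / 2 + Real.sqrt Real.pi / 2, by positivity, fun y hy => ?_⟩
  have hsp : 0 ≤ Real.sqrt Real.pi := Real.sqrt_nonneg _
  rw [Real.rpow_neg_one]
  have hyi : 0 < y⁻¹ := inv_pos.mpr hy
  rcases le_total y 1 with h | h
  · have h3 := h1 y hy
    rw [neg_zero, Real.rpow_zero, mul_one] at h3
    have e3 : ‖(Real.sqrt Real.pi / 2 : ℂ) * (y : ℂ)⁻¹‖ = Real.sqrt Real.pi / 2 * y⁻¹ := by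
      rw [norm_mul, norm_div, norm_inv, Complex.norm_real, Complex.norm_real,
        Real.norm_of_nonneg hsp, Real.norm_of_nonneg hy.le, RCLike.norm_ofNat]
    have e5 : ‖(1/2 : ℂ)‖ = 1 / 2 := by norm_num
    have h1y : 1 ≤ y⁻¹ := (one_le_inv₀ hy).mpr h
    rw [psi_eq]
    have := norm_add_le (TT y - 1/2) ((Real.sqrt Real.pi / 2 : ℂ) * (y : ℂ)⁻¹)
    have := norm_sub_le (TT y) (1/2)
    nlinarith
  · have h3 := h2 y hy
    have : y ^ (-(2:ℝ)) ≤ y ^ (-(1:ℝ)) := Real.rpow_le_rpow_of_exponent_le h (by norm_num)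
    rw [Real.rpow_neg_one] at this
    have := mul_le_mul_of_nonneg_left this hD
    nlinarith [mul_nonneg hC hyi.le, mul_nonneg hsp hyi.le]

lemma EE_PB0 : PB EE 0 := TT_PB0.sub (const_PB _)

lemma EE_PB1 : PB EE 1 := by
  have := psi_PB1.sub (inv_PB.const_mul (Real.sqrt Real.pi / 2 : ℂ))
  refine (funext fun y => EE_eq : EE = _) ▸ this

lemma EE_PB {a : ℝ} (h1 : 0 ≤ a) (h2 : a ≤ 1) : PB EE a := EE_PB0.interp EE_PB1 h1 h2

lemma psi_hasSum {y : ℝ} (hy : 0 < y) : HasSum (fun n : ℕ+ => gs ((n:ℝ) * y)) (psi y) := by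
  have := (psiR_summable hy).hasSum
  exact Complex.hasSum_ofReal.mpr this

/-- Mellin transforms -/
lemma mellin_gs {q : ℂ} (hq : 0 < q.re) : HasMellin gs q (Complex.Gamma (q / 2) / 2) := by
  constructor
  · exact PB.mellinConvergent gs_cont.continuousOn (gs_PB (a := q.re + 1) (by linarith))
      (gs_PB le_rfl) hq (by linarith)
  · have h := mellin_comp_rpow (fun x : ℝ => ((Real.exp (-x) : ℝ) : ℂ)) q 2
    have h2 : (fun t : ℝ => ((Real.exp (-t ^ (2:ℝ)) : ℝ) : ℂ)) = gs := by
      ext t; simp [gs]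
    rw [h2] at h
    rw [h, ← GammaIntegral_eq_mellin]
    have : (0:ℝ) < (q / 2).re := by simp; exact hq
    push_cast
    rw [Complex.Gamma_eq_integral this]
    rw [abs_of_pos (by norm_num : (0:ℝ) < 2)]
    rw [Complex.real_smul]; push_cast; ring

lemma PB.tsum_comp {A : ℝ → ℂ} {a : ℝ} (ha : 1 < a) (hA : PB A a) :
    PB (fun y => ∑' k : ℕ+, A ((k:ℝ) * y)) a := by
  obtain ⟨C, hC, h⟩ := hA
  have hs := pnat_summable ha
  refine ⟨C * ∑' k : ℕ+, (k:ℝ) ^ (-a), mul_nonneg hC (tsum_nonneg fun k => by positivity),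
    fun y hy => ?_⟩
  have h1 : ∀ k : ℕ+, ‖A ((k:ℝ) * y)‖ ≤ (C * y ^ (-a)) * (k:ℝ) ^ (-a) := by
    intro k
    have hk : (0:ℝ) < k := by exact_mod_cast k.pos
    refine (h _ (by positivity)).trans (le_of_eq ?_)
    rw [Real.mul_rpow hk.le hy.le]; ring
  refine (tsum_of_norm_bounded (hs.mul_left (C * y ^ (-a))).hasSum h1).trans (le_of_eq ?_)
  rw [tsum_mul_left]; ring

lemma psi_PB {a : ℝ} (ha : 1 ≤ a) : PB psi a := by
  obtain ⟨C, hC, h⟩ := (gs_PB (a := a + 1) (by linarith)).tsum_comp (by linarith)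
  refine psi_PB1.interp (b := a + 1) ⟨C, hC, fun y hy => ?_⟩ ha (by linarith)
  rw [← (psi_hasSum hy).tsum_eq]
  exact h y hy

lemma mellin_psi {q : ℂ} (hq : 1 < q.re) :
    HasMellin psi q (Complex.Gamma (q / 2) * riemannZeta q / 2) := by
  constructor
  · exact PB.mellinConvergent psi_cont (psi_PB (a := q.re + 1) (by linarith)) psi_PB1 hq
      (by linarith)
  · have h := mellin_comp_rpow (fun x : ℝ => psi (Real.sqrt x)) q 2
    have h2 : (fun t : ℝ => psi (Real.sqrt (t ^ (2:ℝ)))) = psi := by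
      ext t
      rw [Real.rpow_two, Real.sqrt_sq_eq_abs]
      simp [psi, psiR, mul_pow, sq_abs]
    rw [h2] at h
    have hq2 : (q / 2).re = q.re / 2 := by simp
    have key := hasSum_mellin (ι := ℕ+) (a := fun _ => 1) (p := fun n => (n:ℝ) ^ 2)
      (F := fun x : ℝ => psi (Real.sqrt x)) (s := q / 2) (fun n => Or.inr (by
        have : (0:ℝ) < n := by exact_mod_cast n.pos
        positivity)) (by rw [hq2]; linarith) ?_ ?_
    · rw [h]
      push_cast
      rw [← key.tsum_eq, abs_of_pos (by norm_num : (0:ℝ) < 2), Complex.real_smul]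
      have e : ∀ n : ℕ+, Complex.Gamma (q / 2) * 1 / (((n:ℝ) ^ 2 : ℝ) : ℂ) ^ (q / 2) =
          Complex.Gamma (q / 2) * (1 / ((n:ℕ):ℂ) ^ q) := by
        intro n
        have : (0:ℝ) < n := by exact_mod_cast n.pos
        rw [Complex.ofReal_pow, ← Complex.cpow_nat_mul']
        · push_cast
          rw [mul_one, mul_one_div]
          congr 2; ring
        · rw [Complex.arg_ofReal_of_nonneg this.le]; simp [Real.pi_pos]
        · rw [Complex.arg_ofReal_of_nonneg this.le]; simp [Real.pi_pos.le]
      simp_rw [e]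
      rw [tsum_mul_left, zeta_eq_tsum_one_div_nat_add_one_cpow hq,
        tsum_pnat_eq_tsum_succ (f := fun n : ℕ => 1 / (n:ℂ) ^ q)]
      push_cast; ring
    · intro t ht
      have := psi_hasSum (Real.sqrt_pos.mpr ht)
      refine this.congr_fun fun n => ?_
      simp only [gs, one_mul, mul_pow]
      rw [Real.sq_sqrt (le_of_lt ht)]
      congr 2; ring
    · refine (pnat_summable hq).congr fun n => ?_
      have : (0:ℝ) < n := by exact_mod_cast n.pos
      rw [hq2, norm_one, ← Real.rpow_natCast, ← Real.rpow_mul this.le, Real.rpow_neg this.le, one_div]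
      congr 2; push_cast; ring

/-- the basic kernel -/
def Sw (w : ℂ) (u : ℝ) : ℂ := gs u * Complex.sinh (w * u)

lemma norm_sinh_le (x : ℂ) : ‖Complex.sinh x‖ ≤ Real.sinh ‖x‖ := by
  rw [← (Complex.hasSum_sinh x).tsum_eq]
  refine tsum_of_norm_bounded (Real.hasSum_sinh ‖x‖) fun n => ?_
  rw [norm_div, norm_pow]; simp

lemma real_sinh_le {y : ℝ} (hy : 0 ≤ y) : Real.sinh y ≤ y * Real.exp y := by
  rw [Real.sinh_eq]
  have h1 := Real.add_one_le_exp (-(2 * y))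
  have h2 : Real.exp (-y) = Real.exp y * Real.exp (-(2*y)) := by
    rw [← Real.exp_add]; congr 1; ring
  have h3 := Real.exp_pos y
  rw [h2]
  nlinarith

lemma Sw_nice (w : ℂ) : Nice (Sw w) := by
  refine ⟨?_, fun a ha => ?_⟩
  · have := gs_cont
    unfold Sw
    exact Continuous.continuousOn (by fun_prop)
  · obtain ⟨C, hC, h⟩ := rpow_exp_bound (b := 1 + a) (by linarith)
    refine ⟨‖w‖ * Real.exp ((‖w‖ + 1) ^ 2 / 4) * C, by positivity, fun y hy => ?_⟩
    rw [Sw, norm_mul, gs_norm]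
    have h1 : ‖Complex.sinh (w * y)‖ ≤ (‖w‖ * y) * Real.exp (‖w‖ * y) := by
      refine (norm_sinh_le _).trans ?_
      have : ‖w * (y:ℂ)‖ = ‖w‖ * y := by simp [abs_of_pos hy]
      rw [this]
      exact real_sinh_le (by positivity)
    have h2 : Real.exp (-y ^ 2) * Real.exp (‖w‖ * y) ≤
        Real.exp ((‖w‖ + 1) ^ 2 / 4) * Real.exp (-y) := by
      rw [← Real.exp_add, ← Real.exp_add]
      apply Real.exp_le_exp.mpr
      nlinarith [sq_nonneg (y - (‖w‖ + 1) / 2)]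
    have h3 := h y hy
    rw [Real.rpow_add hy, Real.rpow_one] at h3
    have h4 : y * Real.exp (-y) ≤ C * y ^ (-a) := by
      rw [Real.rpow_neg hy.le, ← div_eq_mul_inv, le_div_iff₀ (Real.rpow_pos_of_pos hy _)]
      linarith
    calc Real.exp (-y ^ 2) * ‖Complex.sinh (w * y)‖
        ≤ Real.exp (-y ^ 2) * ((‖w‖ * y) * Real.exp (‖w‖ * y)) := by gcongr
      _ = (‖w‖ * y) * (Real.exp (-y ^ 2) * Real.exp (‖w‖ * y)) := by ring
      _ ≤ (‖w‖ * y) * (Real.exp ((‖w‖ + 1) ^ 2 / 4) * Real.exp (-y)) := by gcongr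
      _ = ‖w‖ * Real.exp ((‖w‖ + 1) ^ 2 / 4) * (y * Real.exp (-y)) := by ring
      _ ≤ ‖w‖ * Real.exp ((‖w‖ + 1) ^ 2 / 4) * (C * y ^ (-a)) := by gcongr
      _ = _ := by ring

lemma poch_zero (a : ℂ) : poch a 0 = 1 := by simp [poch]

lemma poch_succ (a : ℂ) (n : ℕ) : poch a (n + 1) = poch a n * (a + n) := by
  simp [poch, ascPochhammer_succ_eval]

lemma poch_succ_left (a : ℂ) (n : ℕ) : poch a (n + 1) = a * poch (a + 1) n := by
  simp [poch, ascPochhammer_succ_left]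

lemma poch_ne {c : ℂ} (hc : 0 < c.re) (n : ℕ) : poch c n ≠ 0 := by
  induction n with
  | zero => simp [poch_zero]
  | succ n ih =>
    rw [poch_succ]
    refine mul_ne_zero ih fun h => ?_
    have := congrArg Complex.re h
    simp at this
    have : (0:ℝ) ≤ n := n.cast_nonneg
    linarith

lemma Gamma_add_nat {a : ℂ} (ha : 0 < a.re) (n : ℕ) :
    Complex.Gamma (a + n) = Complex.Gamma a * poch a n := by
  induction n with
  | zero => simp [poch_zero]
  | succ n ih =>
    have : a + n ≠ 0 := by
      intro h
      have := congrArg Complex.re h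
      simp at this
      have : (0:ℝ) ≤ n := n.cast_nonneg
      linarith
    push_cast
    rw [← add_assoc, Complex.Gamma_add_one _ this, ih, poch_succ]; ring

lemma fact_odd (n : ℕ) : ((2 * n + 1).factorial : ℂ) = n.factorial * 4 ^ n * poch (3/2) n := by
  induction n with
  | zero => simp [poch_zero]
  | succ n ih =>
    rw [show 2 * (n + 1) + 1 = (2 * n + 1) + 1 + 1 by ring, Nat.factorial_succ (2 * n + 1 + 1),
      Nat.factorial_succ (2 * n + 1), Nat.factorial_succ n, poch_succ]
    push_cast
    rw [ih]; ring

lemma oneF1_summable (a x : ℂ) :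
    Summable (fun n : ℕ => poch a n / poch (3/2) n * x ^ n / (n.factorial : ℂ)) := by
  refine summable_of_ratio_norm_eventually_le (r := 1/2) (by norm_num) ?_
  filter_upwards [eventually_ge_atTop (⌈2 * ((‖a‖ + 1) * ‖x‖)⌉₊)] with n hn
  have hn' : 2 * ((‖a‖ + 1) * ‖x‖) ≤ n := (Nat.le_ceil _).trans (by exact_mod_cast hn)
  have hn0 : (0:ℝ) ≤ n := n.cast_nonneg
  have e : poch a (n+1) / poch (3/2) (n+1) * x ^ (n+1) / ((n+1).factorial : ℂ) =
      (((a + n) * x) / ((3/2 + n) * (n + 1))) *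
        (poch a n / poch (3/2) n * x ^ n / (n.factorial : ℂ)) := by
    rw [poch_succ, poch_succ, Nat.factorial_succ, pow_succ]
    push_cast
    field_simp
  rw [e, norm_mul]
  refine mul_le_mul_of_nonneg_right ?_ (norm_nonneg _)
  rw [norm_div, norm_mul, norm_mul]
  have h1 : ‖(3/2 + n : ℂ)‖ = 3/2 + n := by
    rw [show (3/2 + n : ℂ) = ((3/2 + n : ℝ) : ℂ) by push_cast; ring, Complex.norm_real,
      Real.norm_of_nonneg (by positivity)]
  have h2 : ‖(n + 1 : ℂ)‖ = n + 1 := by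
    rw [show (n + 1 : ℂ) = ((n + 1 : ℝ) : ℂ) by push_cast; ring, Complex.norm_real,
      Real.norm_of_nonneg (by positivity)]
  have h3 : ‖a + n‖ ≤ (‖a‖ + 1) * (n + 1) := by
    refine (norm_add_le _ _).trans ?_
    simp
    nlinarith [norm_nonneg a, mul_nonneg (norm_nonneg a) hn0]
  rw [h1, h2, div_le_iff₀ (by positivity)]
  calc ‖a + n‖ * ‖x‖ ≤ ((‖a‖ + 1) * (n + 1)) * ‖x‖ := by gcongr
    _ = ((‖a‖ + 1) * ‖x‖) * (n + 1) := by ring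
    _ ≤ (n / 2) * (n + 1) := by gcongr; linarith
    _ ≤ _ := by nlinarith

lemma oneF1_hasSum (a x : ℂ) :
    HasSum (fun n : ℕ => poch a n / poch (3/2) n * x ^ n / (n.factorial : ℂ)) (oneF1 a (3/2) x) :=
  (oneF1_summable a x).hasSum

lemma kummer_comb (n : ℕ) : ∀ b c : ℂ, 0 < c.re →
    ∑ ij ∈ Finset.HasAntidiagonal.antidiagonal n, (n.choose ij.1 : ℂ) * ((-1) ^ ij.1 * poch b ij.1 / poch c ij.1) =
      poch (c - b) n / poch c n := by
  induction n with
  | zero => intro b c hc; simp [poch_zero]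
  | succ n ih =>
    intro b c hc
    have hc0 : c ≠ 0 := fun h => by simp [h] at hc
    have h := Finset.sum_antidiagonal_choose_succ_mul
      (fun i _ => ((-1) ^ i * poch b i / poch c i : ℂ)) n
    rw [h, ih b c hc]
    have h2 : ∑ ij ∈ Finset.HasAntidiagonal.antidiagonal n, (n.choose ij.2 : ℂ) *
        ((-1) ^ (ij.1 + 1) * poch b (ij.1 + 1) / poch c (ij.1 + 1)) =
        (-(b / c)) * (poch ((c + 1) - (b + 1)) n / poch (c + 1) n) := by
      rw [← ih (b + 1) (c + 1) (by simp; linarith), Finset.mul_sum]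
      refine Finset.sum_congr rfl fun ij hij => ?_
      have hs : n.choose ij.2 = n.choose ij.1 := by
        have := Finset.HasAntidiagonal.mem_antidiagonal.mp hij
        rw [← this, Nat.choose_symm_add]
      rw [hs, poch_succ_left, poch_succ_left]
      have := poch_ne (c := c + 1) (by simp; linarith) ij.1
      field_simp
      ring
    rw [h2, show c + 1 - (b + 1) = c - b by ring, poch_succ (c - b)]
    have e1 : poch (c + 1) n = poch c n * (c + n) / c := by
      rw [← poch_succ, poch_succ_left]; field_simp
    have e2 := poch_ne hc n
    have e3 := poch_ne hc (n + 1)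
    rw [poch_succ] at e3
    have e4 : c + n ≠ 0 := fun h => e3 (by rw [h, mul_zero])
    rw [e1, poch_succ]
    field_simp
    ring

theorem kummer (b x : ℂ) :
    Complex.exp x * oneF1 b (3/2) (-x) = oneF1 (3/2 - b) (3/2) x := by
  have h1 := oneF1_summable b (-x)
  have h2 := NormedSpace.expSeries_div_summable (𝔸 := ℂ) x
  have h := tsum_mul_tsum_eq_tsum_sum_antidiagonal_of_summable_norm h1.norm h2.norm
  rw [(NormedSpace.expSeries_div_hasSum_exp x).tsum_eq, ← Complex.exp_eq_exp_ℂ] at h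
  rw [mul_comm]
  unfold oneF1
  rw [h]
  congr 1
  ext n
  rw [← kummer_comb n b (3/2) (by norm_num), Finset.sum_mul, Finset.sum_div]
  refine Finset.sum_congr rfl fun ij hij => ?_
  have hn := Finset.HasAntidiagonal.mem_antidiagonal.mp hij
  have hch : ((n.choose ij.1 : ℕ) : ℂ) * ij.1.factorial * ij.2.factorial = n.factorial := by
    rw [← hn, Nat.choose_symm_add]
    exact_mod_cast Nat.add_choose_mul_factorial_mul_factorial ij.1 ij.2
  have p := poch_ne (c := 3/2) (by norm_num) ij.1
  have f1 : (ij.1.factorial : ℂ) ≠ 0 := by exact_mod_cast ij.1.factorial_ne_zero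
  have f2 : (ij.2.factorial : ℂ) ≠ 0 := by exact_mod_cast ij.2.factorial_ne_zero
  have f3 : (n.factorial : ℂ) ≠ 0 := by exact_mod_cast n.factorial_ne_zero
  have hx : x ^ n = x ^ ij.1 * x ^ ij.2 := by rw [← hn, pow_add]
  rw [hx, neg_pow, div_mul_div_comm, div_eq_div_iff (mul_ne_zero f1 f2) f3, ← hch]
  ring

theorem cerf_eq (w : ℂ) :
    cerf w = (2 / (Real.sqrt Real.pi : ℂ)) * (w * oneF1 (1/2) (3/2) (-w ^ 2)) := by
  unfold cerf
  congr 1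
  rw [intervalIntegral.integral_const_mul]
  congr 1
  have h := intervalIntegral.hasSum_integral_of_dominated_convergence (a := 0) (b := 1)
    (μ := volume)
    (F := fun (n : ℕ) (t : ℝ) => (-((t:ℂ) * w) ^ 2) ^ n / (n.factorial : ℂ))
    (f := fun t : ℝ => Complex.exp (-((t:ℂ) * w) ^ 2))
    (fun n _ => (‖w‖ ^ 2) ^ n / n.factorial) ?_ ?_ ?_ ?_ ?_
  · rw [← h.tsum_eq, oneF1]
    congr 1
    ext n
    have e : ∀ t : ℝ, (-((t:ℂ) * w) ^ 2) ^ n / (n.factorial : ℂ) =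
        ((-w ^ 2) ^ n / (n.factorial : ℂ)) * ((t ^ (2 * n) : ℝ) : ℂ) := by
      intro t
      push_cast
      rw [mul_pow, pow_mul, show -((t:ℂ) ^ 2 * w ^ 2) = (-w ^ 2) * (t:ℂ)^2 by ring, mul_pow]
      ring
    simp_rw [e]
    rw [intervalIntegral.integral_const_mul, intervalIntegral.integral_ofReal, integral_pow]
    have p : poch (1/2) n / poch (3/2) n = 1 / (2 * n + 1) := by
      have h1 : poch (1/2) n * (1/2 + n) = 1/2 * poch (3/2) n := by
        rw [← poch_succ, poch_succ_left]; norm_num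
      have h2 := poch_ne (c := 3/2) (by norm_num) n
      have h3 : (2 * n + 1 : ℂ) ≠ 0 := by exact_mod_cast (Nat.succ_ne_zero (2 * n))
      rw [div_eq_div_iff h2 h3]
      linear_combination 2 * h1
    rw [p]
    push_cast
    simp
    ring
  · intro n
    exact Continuous.aestronglyMeasurable (by fun_prop)
  · intro n
    refine Eventually.of_forall fun t ht => ?_
    rw [uIoc_of_le zero_le_one] at ht
    rw [norm_div, norm_pow, norm_neg, norm_pow, norm_mul]
    simp only [Complex.norm_real, Complex.norm_natCast]
    rw [Real.norm_of_nonneg ht.1.le]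
    have : t * ‖w‖ ≤ ‖w‖ := by nlinarith [ht.2, norm_nonneg w]
    have h0 := ht.1.le
    gcongr
  · refine Eventually.of_forall fun t ht => ?_
    exact Real.summable_pow_div_factorial _
  · exact intervalIntegrable_const
  · refine Eventually.of_forall fun t ht => ?_
    rw [Complex.exp_eq_exp_ℂ]
    exact NormedSpace.expSeries_div_hasSum_exp _

theorem mellin_Sw (w : ℂ) {p : ℂ} (hp : -1 < p.re) :
    mellin (Sw w) p = (w / 2) * Complex.Gamma ((p + 1) / 2) *
      oneF1 ((p + 1) / 2) (3/2) (w ^ 2 / 4) := by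
  have h := hasSum_integral_of_dominated_convergence (μ := volume.restrict (Ioi (0:ℝ)))
    (F := fun (n : ℕ) (u : ℝ) => (w ^ (2 * n + 1) / ((2 * n + 1).factorial : ℂ)) *
      ((u:ℂ) ^ ((p + (2 * n + 1)) - 1) • gs u))
    (f := fun u : ℝ => (u:ℂ) ^ (p - 1) • Sw w u)
    (fun n u => u ^ (p.re - 1) * Real.exp (-u^2) *
      ((‖w‖ * u) ^ (2 * n + 1) / ((2 * n + 1).factorial : ℝ))) ?_ ?_ ?_ ?_ ?_
  · rw [mellin, ← h.tsum_eq, oneF1, ← tsum_mul_left]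
    congr 1
    ext n
    rw [integral_const_mul]
    have hm := (mellin_gs (q := p + (2 * n + 1)) (by
      simp; have : (0:ℝ) ≤ n := n.cast_nonneg
      linarith)).2
    rw [mellin] at hm
    rw [hm, show (p + (2 * n + 1)) / 2 = (p + 1) / 2 + n by ring, Gamma_add_nat (by
      simp; linarith), fact_odd]
    have h2 := poch_ne (c := 3/2) (by norm_num) n
    have f1 : (n.factorial : ℂ) ≠ 0 := by exact_mod_cast n.factorial_ne_zero
    rw [div_pow, pow_succ, pow_mul]
    field_simp
  · intro n
    refine AEStronglyMeasurable.const_mul ?_ _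
    refine ContinuousOn.aestronglyMeasurable ?_ measurableSet_Ioi
    refine ContinuousOn.smul (M := ℂ) (f := fun u : ℝ => (u:ℂ) ^ ((p + (2 * n + 1)) - 1)) ?_
      gs_cont.continuousOn
    intro u hu
    exact (continuousAt_ofReal_cpow_const _ _ (Or.inr (ne_of_gt hu))).continuousWithinAt
  · intro n
    filter_upwards [ae_restrict_mem measurableSet_Ioi] with u hu
    have hu' : (0:ℝ) < u := hu
    rw [norm_mul, norm_smul, gs_norm, norm_ofReal_cpow_pos hu', norm_div, norm_pow, Complex.norm_natCast]
    have : (p + (2 * n + 1) - 1).re = (p.re - 1) + ((2 * n + 1 : ℕ) : ℝ) := by simp; ring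
    rw [this, Real.rpow_add hu', Real.rpow_natCast, mul_pow]
    refine le_of_eq ?_
    ring
  · filter_upwards with u
    exact (Real.hasSum_sinh (‖w‖ * u)).summable.mul_left _
  · have h1 := ((Sw_nice (‖w‖ : ℂ)).absInt (a := p.re) hp)
    refine h1.congr ?_
    filter_upwards [ae_restrict_mem measurableSet_Ioi] with u hu
    have hu' : (0:ℝ) < u := hu
    rw [tsum_mul_left, (Real.hasSum_sinh (‖w‖ * u)).tsum_eq, Sw, norm_mul, gs_norm, mul_assoc]
    have : Complex.sinh ((‖w‖:ℂ) * u) = ((Real.sinh (‖w‖ * u) : ℝ) : ℂ) := by push_cast; rfl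
    rw [this, Complex.norm_real, Real.norm_of_nonneg (Real.sinh_nonneg_iff.mpr (by positivity))]
  · filter_upwards [ae_restrict_mem measurableSet_Ioi] with u hu
    have hu' : (0:ℝ) < u := hu
    have h1 := (Complex.hasSum_sinh (w * u)).mul_left ((u:ℂ) ^ (p - 1) * gs u)
    have e : (u:ℂ) ^ (p - 1) * gs u * Complex.sinh (w * u) = (u:ℂ) ^ (p - 1) • Sw w u := by
      rw [Sw, smul_eq_mul]; ring
    rw [e] at h1
    refine h1.congr_fun fun n => ?_
    have hu0 : (u:ℂ) ≠ 0 := by exact_mod_cast hu'.ne'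
    rw [show p + (2 * n + 1) - 1 = (p - 1) + ((2 * n + 1 : ℕ) : ℂ) by push_cast; ring,
      Complex.cpow_add _ _ hu0, Complex.cpow_natCast, mul_pow, smul_eq_mul]
    ring

lemma punct_preconn (a : ℝ) (b : ℝ) (ha : a < 1) (hb : 1 < b) :
    IsPreconnected {s : ℂ | a < s.re ∧ s.re < b ∧ s ≠ 1} := by
  set R : Set ℂ := {s | 1 < s.re ∧ s.re < b} with hR
  set L : Set ℂ := {s | a < s.re ∧ s.re < 1} with hL
  set U : Set ℂ := {s | (a < s.re ∧ s.re < b) ∧ 0 < s.im} with hU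
  set D : Set ℂ := {s | (a < s.re ∧ s.re < b) ∧ s.im < 0} with hD
  have cgt : ∀ r : ℝ, Convex ℝ {s : ℂ | r < s.re} := fun r => convex_halfSpace_re_gt r
  have clt : ∀ r : ℝ, Convex ℝ {s : ℂ | s.re < r} := fun r => convex_halfSpace_re_lt r
  have cR : IsPreconnected R := ((cgt 1).inter (clt b)).isPreconnected
  have cL : IsPreconnected L := ((cgt a).inter (clt 1)).isPreconnected
  have cU : IsPreconnected U :=
    (((cgt a).inter (clt b)).inter (convex_halfSpace_im_gt 0)).isPreconnected
  have cD : IsPreconnected D :=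
    (((cgt a).inter (clt b)).inter (convex_halfSpace_im_lt 0)).isPreconnected
  have h1 : IsPreconnected (R ∪ U) := cR.union (⟨(1 + b) / 2, 1⟩ : ℂ)
    (by simp only [hR, mem_setOf_eq]; constructor <;> linarith)
    (by simp only [hU, mem_setOf_eq]; refine ⟨⟨?_, ?_⟩, ?_⟩ <;> linarith) cU
  have h2 : IsPreconnected ((R ∪ U) ∪ D) := h1.union (⟨(1 + b) / 2, -1⟩ : ℂ)
    (by left; simp only [hR, mem_setOf_eq]; constructor <;> linarith)
    (by simp only [hD, mem_setOf_eq]; refine ⟨⟨?_, ?_⟩, ?_⟩ <;> linarith) cD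
  have h3 : IsPreconnected (((R ∪ U) ∪ D) ∪ L) := h2.union (⟨(a + 1) / 2, 1⟩ : ℂ)
    (by left; right; simp only [hU, mem_setOf_eq]; refine ⟨⟨?_, ?_⟩, ?_⟩ <;> linarith)
    (by simp only [hL, mem_setOf_eq]; constructor <;> linarith) cL
  convert h3 using 1
  ext s
  simp only [mem_setOf_eq, mem_union, hR, hL, hU, hD]
  constructor
  · rintro ⟨h1, h2, h3⟩
    rcases lt_trichotomy s.re 1 with h | h | h
    · right; exact ⟨h1, h⟩
    · rcases lt_trichotomy s.im 0 with k | k | k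
      · left; right; exact ⟨⟨h1, h2⟩, k⟩
      · exact absurd (Complex.ext (by simpa using h) (by simpa using k)) h3
      · left; left; right; exact ⟨⟨h1, h2⟩, k⟩
    · left; left; left; exact ⟨h, h2⟩
  · intro h
    have hne : (s.re ≠ 1 ∨ s.im ≠ 0) → s ≠ 1 := by
      rintro h rfl; simp at h
    rcases h with ((h | h) | h) | h
    · exact ⟨by linarith [h.1], h.2, hne (Or.inl (ne_of_gt h.1))⟩
    · exact ⟨h.1.1, h.1.2, hne (Or.inr (ne_of_gt h.2))⟩
    · exact ⟨h.1.1, h.1.2, hne (Or.inr (ne_of_lt h.2))⟩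
    · exact ⟨h.1, by linarith [h.2], hne (Or.inl (ne_of_lt h.2))⟩

lemma punct_open (a b : ℝ) : IsOpen {s : ℂ | a < s.re ∧ s.re < b ∧ s ≠ 1} := by
  have h1 : IsOpen {s : ℂ | a < s.re} := isOpen_lt continuous_const Complex.continuous_re
  have h2 : IsOpen {s : ℂ | s.re < b} := isOpen_lt Complex.continuous_re continuous_const
  exact h1.inter (h2.inter isOpen_ne)

/-- identity theorem on a punctured strip -/
lemma ident_strip {f g : ℂ → ℂ} {a b : ℝ} (ha : a < 1) (hb : 1 < b)
    (hf : ∀ s : ℂ, a < s.re → s.re < b → s ≠ 1 → DifferentiableAt ℂ f s)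
    (hg : ∀ s : ℂ, a < s.re → s.re < b → s ≠ 1 → DifferentiableAt ℂ g s)
    (h : ∀ s : ℂ, 1 < s.re → s.re < b → f s = g s)
    {s : ℂ} (h1 : a < s.re) (h2 : s.re < b) (h3 : s ≠ 1) : f s = g s := by
  have hf' : AnalyticOnNhd ℂ f {s : ℂ | a < s.re ∧ s.re < b ∧ s ≠ 1} :=
    DifferentiableOn.analyticOnNhd (fun s hs => (hf s hs.1 hs.2.1 hs.2.2).differentiableWithinAt)
      (punct_open a b)
  have hg' : AnalyticOnNhd ℂ g {s : ℂ | a < s.re ∧ s.re < b ∧ s ≠ 1} :=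
    DifferentiableOn.analyticOnNhd (fun s hs => (hg s hs.1 hs.2.1 hs.2.2).differentiableWithinAt)
      (punct_open a b)
  set z0 : ℂ := (((1 + b) / 2 : ℝ) : ℂ) with hz0
  have hr : z0.re = (1 + b) / 2 := by rw [hz0, Complex.ofReal_re]
  refine hf'.eqOn_of_preconnected_of_eventuallyEq hg' (punct_preconn a b ha hb) (z₀ := z0)
    ⟨by rw [hr]; linarith, by rw [hr]; linarith, ?_⟩ ?_ ⟨h1, h2, h3⟩
  · intro h; rw [h] at hr; simp at hr; linarith
  · have o1 : IsOpen {s : ℂ | 1 < s.re} := isOpen_lt continuous_const Complex.continuous_re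
    have o2 : IsOpen {s : ℂ | s.re < b} := isOpen_lt Complex.continuous_re continuous_const
    filter_upwards [(o1.inter o2).mem_nhds (show z0 ∈ _ from
      ⟨by simp only [mem_setOf_eq]; rw [hr]; linarith, by simp only [mem_setOf_eq]; rw [hr]; linarith⟩)] with s hs
    exact h s hs.1 hs.2

/-- auxiliary regularization of psi -/
def N1 (y : ℝ) : ℂ :=
  psi y - (√Real.pi / 2 : ℂ) * indicator (Ioc 0 1) (fun t : ℝ => (t:ℂ) ^ (-1:ℂ)) y

lemma N1_PB {a : ℝ} (ha : 0 ≤ a) : PB N1 a := by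
  have h0 : PB N1 0 := by
    obtain ⟨C, hC, h⟩ := EE_PB0
    obtain ⟨D, hD, h'⟩ := psi_PB1
    refine ⟨C + D, by positivity, fun y hy => ?_⟩
    simp only [neg_zero, Real.rpow_zero, mul_one] at h ⊢
    rcases le_or_gt y 1 with h1 | h1
    · have : N1 y = EE y := by
        rw [N1, EE_eq, indicator_of_mem (show y ∈ Ioc (0:ℝ) 1 from ⟨hy, h1⟩), cpow_neg_one]
      rw [this]; linarith [h y hy]
    · have : N1 y = psi y := by
        rw [N1, indicator_of_notMem (by simp [h1])]; simp
      rw [this]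
      have h2 : y ^ (-1:ℝ) ≤ 1 := Real.rpow_le_one_of_one_le_of_nonpos h1.le (by norm_num)
      nlinarith [h' y hy]
  have hb : PB N1 (a + 1) := by
    obtain ⟨C, hC, h⟩ := h0
    obtain ⟨D, hD, h'⟩ := psi_PB (a := a + 1) (by linarith)
    refine ⟨C + D, by positivity, fun y hy => ?_⟩
    simp only [neg_zero, Real.rpow_zero, mul_one] at h
    have hp := Real.rpow_nonneg hy.le (-(a+1))
    rcases le_or_gt y 1 with h1 | h1
    · have h2 : 1 ≤ y ^ (-(a+1)) := Real.one_le_rpow_of_pos_of_le_one_of_nonpos hy h1 (by linarith)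
      nlinarith [h y hy, mul_nonneg hD hp]
    · have : N1 y = psi y := by
        rw [N1, indicator_of_notMem (by simp [h1])]; simp
      rw [this]
      nlinarith [h' y hy, mul_nonneg hC hp]
  exact h0.interp hb ha (by linarith)

lemma N1_locInt : LocallyIntegrableOn N1 (Ioi 0) := by
  refine (psi_cont.locallyIntegrableOn measurableSet_Ioi).sub ?_
  have : ContinuousOn (fun t : ℝ => (t:ℂ) ^ (-1:ℂ)) (Ioi 0) := fun u hu =>
    (continuousAt_ofReal_cpow_const _ _ (Or.inr (ne_of_gt hu))).continuousWithinAt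
  have h := this.locallyIntegrableOn (μ := volume) measurableSet_Ioi
  have h2 : LocallyIntegrableOn (indicator (Ioc 0 1) (fun t : ℝ => (t:ℂ) ^ (-1:ℂ))) (Ioi 0) := by
    intro x hx
    obtain ⟨t, ht, hi⟩ := h x hx
    exact ⟨t, ht, hi.indicator measurableSet_Ioc⟩
  intro x hx
  obtain ⟨t, ht, hi⟩ := h2 x hx
  exact ⟨t, ht, hi.const_mul _⟩

lemma mellin_N1_conv {q : ℂ} (hq : 0 < q.re) : MellinConvergent N1 q :=
  mellinConvergent_of_isBigO_rpow N1_locInt (N1_PB (a := q.re + 1) (by linarith)).top (by linarith)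
    (N1_PB (a := 0) le_rfl).bot hq

lemma mellin_N1 {q : ℂ} (hq : 0 < q.re) (hq2 : q.re < 2) (hq1 : q ≠ 1) :
    mellin N1 q = Complex.Gamma (q / 2) * riemannZeta q / 2 - (√Real.pi / 2 : ℂ) * (1 / (q - 1)) := by
  refine ident_strip (f := mellin N1) (g := fun q => Complex.Gamma (q / 2) * riemannZeta q / 2
    - (√Real.pi / 2 : ℂ) * (1 / (q - 1))) (a := 0) (b := 2) (by norm_num) (by norm_num) ?_ ?_ ?_ hq hq2 hq1
  · intro s hs _ _
    exact mellin_differentiableAt_of_isBigO_rpow N1_locInt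
      (N1_PB (a := s.re + 1) (by linarith)).top (by linarith) (N1_PB (a := 0) le_rfl).bot hs
  · intro s hs _ h1
    have e1 : DifferentiableAt ℂ (fun q => Complex.Gamma (q / 2)) s := by
      refine DifferentiableAt.comp (g := Complex.Gamma) (f := fun q => q / 2) s ?_ (by fun_prop)
      refine Complex.differentiableAt_Gamma _ fun m h => ?_
      have := congrArg Complex.re h
      simp at this
      have hm : (0:ℝ) ≤ m := m.cast_nonneg
      linarith
    have e2 := differentiableAt_riemannZeta h1
    have e3 : DifferentiableAt ℂ (fun q : ℂ => 1 / (q - 1)) s :=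
      (differentiableAt_const _).div (by fun_prop) (sub_ne_zero.mpr h1)
    exact ((e1.mul e2).div_const _).sub (e3.const_mul _)
  · intro s hs _
    have h1 := mellin_psi hs
    have h2 := hasMellin_cpow_Ioc (-1) (s := s) (by simp; linarith)
    have h3 := (h2.1.const_smul (√Real.pi / 2 : ℂ))
    have h4 := (hasMellin_sub h1.1 h3).2
    rw [mellin_const_smul, h1.2, h2.2] at h4
    have h5 : mellin N1 s = _ := h4
    rw [h5, smul_eq_mul, ← sub_eq_add_neg]

theorem mellin_EE {q : ℂ} (hq : 0 < q.re) (hq1 : q.re < 1) :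
    HasMellin EE q (Complex.Gamma (q / 2) * riemannZeta q / 2) := by
  have hc : MellinConvergent EE q := PB.mellinConvergent EE_cont EE_PB1 EE_PB0 hq hq1
  refine ⟨hc, ?_⟩
  have hq1' : q ≠ 1 := by rintro rfl; simp at hq1
  have h1 := mellin_N1_conv hq
  have h2 := mellin_N1 hq (by linarith) hq1'
  have h3 := (hasMellin_sub h1 hc).2
  have h4 : mellin (fun t => N1 t - EE t) q = (√Real.pi / 2 : ℂ) * (-(1 / (q - 1))) := by
    have e : ∀ y ∈ Ioi (0:ℝ), (y:ℂ) ^ (q - 1) • (N1 y - EE y) =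
        indicator (Ioi 1) (fun y : ℝ => (√Real.pi / 2 : ℂ) * (y:ℂ) ^ (q - 2)) y := by
      intro y hy
      have hy' : (0:ℝ) < y := hy
      have hy0 : (y:ℂ) ≠ 0 := by exact_mod_cast hy'.ne'
      rw [N1, EE_eq, smul_eq_mul]
      rcases le_or_gt y 1 with h1 | h1
      · rw [indicator_of_mem (show y ∈ Ioc (0:ℝ) 1 from ⟨hy, h1⟩), cpow_neg_one,
          indicator_of_notMem (by simp [h1])]
        ring
      · rw [indicator_of_notMem (by simp [h1]), indicator_of_mem (show y ∈ Ioi (1:ℝ) from h1),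
          show q - 2 = (q - 1) - 1 by ring, Complex.cpow_sub (q - 1) 1 hy0, Complex.cpow_one]
        ring
    rw [mellin, setIntegral_congr_fun measurableSet_Ioi e, setIntegral_indicator measurableSet_Ioi,
      Ioi_inter_Ioi, integral_const_mul]
    rw [show max (0:ℝ) 1 = 1 by norm_num, integral_Ioi_cpow_of_lt (by simp; linarith) one_pos]
    simp
    rw [show q - 2 + 1 = q - 1 by ring, neg_div, one_div]
    ring
  rw [h4, h2] at h3
  linear_combination h3

lemma pnat_pos (k : ℕ+) : (0:ℝ) < k := by exact_mod_cast k.pos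

lemma comp_mul_contOn {A : ℝ → ℂ} (hA : ContinuousOn A (Ioi 0)) {k : ℝ} (hk : 0 < k) :
    ContinuousOn (fun r => A (k * r)) (Ioi 0) :=
  hA.comp (by fun_prop) (fun r hr => mul_pos hk hr)

lemma cpow_contOn (s : ℂ) : ContinuousOn (fun r : ℝ => (r:ℂ) ^ s) (Ioi 0) := fun u hu =>
    (continuousAt_ofReal_cpow_const _ _ (Or.inr (ne_of_gt hu))).continuousWithinAt

theorem sumM {A H : ℝ → ℂ} {a : ℝ} (ha : 1 < a) (hAc : ContinuousOn A (Ioi 0)) (hA : PB A a)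
    (hHc : ContinuousOn H (Ioi 0)) {s : ℂ}
    (hH : IntegrableOn (fun r : ℝ => r ^ (s.re - a - 1) * ‖H r‖) (Ioi 0)) :
    HasSum (fun k : ℕ+ => mellin (fun r => A (k * r) * H r) s)
      (mellin (fun r => (∑' k : ℕ+, A (k * r)) * H r) s) := by
  obtain ⟨C, hC, h⟩ := hA
  have hb : ∀ k : ℕ+, ∀ r ∈ Ioi (0:ℝ), ‖(r:ℂ) ^ (s - 1) • (A (k * r) * H r)‖ ≤
      (C * (k:ℝ) ^ (-a)) * (r ^ (s.re - a - 1) * ‖H r‖) := by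
    intro k r hr
    have hr' : (0:ℝ) < r := hr
    have hk := pnat_pos k
    have h1 := h (k * r) (by positivity)
    rw [Real.mul_rpow hk.le hr'.le] at h1
    rw [norm_smul, norm_mul, norm_ofReal_cpow_pos hr', show s.re - a - 1 = (s - 1).re + (-a) by
      simp; ring, Real.rpow_add hr']
    calc r ^ (s - 1).re * (‖A (k * r)‖ * ‖H r‖)
        ≤ r ^ (s - 1).re * ((C * ((k:ℝ) ^ (-a) * r ^ (-a))) * ‖H r‖) := by gcongr
      _ = _ := by ring
  have hIntg : ∀ k : ℕ+, Integrable (fun r : ℝ => (r:ℂ) ^ (s - 1) • (A (k * r) * H r))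
      (volume.restrict (Ioi 0)) := by
    intro k
    refine (hH.const_mul (C * (k:ℝ) ^ (-a))).mono' ?_ ?_
    · refine ContinuousOn.aestronglyMeasurable ?_ measurableSet_Ioi
      exact (cpow_contOn (s - 1)).smul ((comp_mul_contOn hAc (pnat_pos k)).mul hHc)
    · filter_upwards [ae_restrict_mem measurableSet_Ioi] with r hr
      exact hb k r hr
  have := hasSum_integral_of_summable_integral_norm hIntg ?_
  · have e : ∀ r : ℝ, ∑' k : ℕ+, (r:ℂ) ^ (s - 1) • (A (k * r) * H r) =
        (r:ℂ) ^ (s - 1) • ((∑' k : ℕ+, A (k * r)) * H r) := by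
      intro r
      simp only [smul_eq_mul]
      rw [tsum_mul_left, tsum_mul_right]
    simp_rw [e] at this
    exact this
  · refine Summable.of_nonneg_of_le (fun k => integral_nonneg fun r => norm_nonneg _) (fun k => ?_)
      (((pnat_summable ha).mul_left C).mul_right (∫ r in Ioi (0:ℝ), r ^ (s.re - a - 1) * ‖H r‖))
    rw [← integral_const_mul]
    refine integral_mono_ae (hIntg k).norm (hH.const_mul _) ?_
    filter_upwards [ae_restrict_mem measurableSet_Ioi] with r hr
    exact hb k r hr

theorem cv_psi_hasSum {f : ℝ → ℂ} (hf : Nice f) {r : ℝ} (hr : 0 < r) :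
    HasSum (fun k : ℕ+ => cv f gs (k * r)) (cv f psi r) := by
  obtain ⟨C, hC, h⟩ := gs_PB (a := 2) (by norm_num)
  have hIntg : ∀ k : ℕ+, Integrable (fun u : ℝ => f u * gs (k * r / u) / u)
      (volume.restrict (Ioi 0)) := fun k =>
    cv_integrable hf gs_cont.continuousOn (a := 2) (by norm_num) ⟨C, hC, h⟩
      (mul_pos (pnat_pos k) hr)
  have := hasSum_integral_of_summable_integral_norm hIntg ?_
  · suffices e : cv f psi r = ∫ u in Ioi (0:ℝ), ∑' k : ℕ+, f u * gs (k * r / u) / u by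
      rw [e]; exact this
    refine setIntegral_congr_fun measurableSet_Ioi fun u hu => ?_
    have hu' : (0:ℝ) < u := hu
    have h1 := (psi_hasSum (div_pos hr hu')).tsum_eq
    rw [← h1, tsum_div_const, tsum_mul_left]
    simp_rw [mul_div_assoc]
  · refine Summable.of_nonneg_of_le (fun k => integral_nonneg fun r => norm_nonneg _) (fun k => ?_)
      (((pnat_summable (a := 2) (by norm_num)).mul_left (C * r ^ (-2:ℝ))).mul_right
        (∫ u in Ioi (0:ℝ), u ^ ((2:ℝ) - 1) * ‖f u‖))
    have hk := pnat_pos k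
    rw [← integral_const_mul]
    refine integral_mono_ae (hIntg k).norm ((hf.absInt (by norm_num)).const_mul _) ?_
    filter_upwards [ae_restrict_mem measurableSet_Ioi] with u hu
    refine (cv_dom h (mul_pos hk hr) hu).trans (le_of_eq ?_)
    rw [Real.mul_rpow hk.le hr.le]; ring

lemma cv_const (f : ℝ → ℂ) (c : ℂ) (r : ℝ) : cv f (fun _ => c) r = c * mellin f 0 := by
  rw [cv, mellin, ← integral_const_mul]
  refine setIntegral_congr_fun measurableSet_Ioi fun u hu => ?_
  simp only [zero_sub, cpow_neg_one, smul_eq_mul]; ring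

lemma cv_inv (f : ℝ → ℂ) (c : ℂ) (r : ℝ) :
    cv f (fun y => c * (y:ℂ)⁻¹) r = c * (r:ℂ)⁻¹ * mellin f 1 := by
  rw [cv, mellin, ← integral_const_mul]
  refine setIntegral_congr_fun measurableSet_Ioi fun u hu => ?_
  have hu' : (0:ℝ) < u := hu
  have hu0 : (u:ℂ) ≠ 0 := by exact_mod_cast hu'.ne'
  simp only [sub_self, cpow_zero, smul_eq_mul, ofReal_div, inv_div]
  field_simp

lemma inv_contOn (c : ℂ) : ContinuousOn (fun y : ℝ => c * (y:ℂ)⁻¹) (Ioi 0) := by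
  refine continuousOn_const.mul (ContinuousOn.inv₀ (by fun_prop) ?_)
  intro u hu; simpa using (ne_of_gt hu)

theorem cv_psi_eq {f : ℝ → ℂ} (hf : Nice f) {r : ℝ} (hr : 0 < r) :
    cv f psi r = cv f TT r - 1/2 * mellin f 0 + (√Real.pi / 2 : ℂ) * (r:ℂ)⁻¹ * mellin f 1 := by
  have i1 := cv_integrable hf TT_cont (a := 0) (by norm_num) TT_PB0 hr
  have i2 := cv_integrable hf continuousOn_const (a := 0) (by norm_num) (const_PB (1/2)) hr
  have i3 := cv_integrable hf (inv_contOn (√Real.pi / 2 : ℂ)) (a := 1) (by norm_num)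
    (inv_PB.const_mul _) hr
  rw [← cv_const f (1/2) r, ← cv_inv, cv, cv, cv, cv, ← integral_sub i1 i2]
  have i12 : IntegrableOn (fun u : ℝ => f u * TT (r / u) / u - f u * (1/2) / u) (Ioi 0) := i1.sub i2
  rw [← integral_add i12 i3]
  congr 1
  ext u
  rw [psi_eq]
  ring

theorem cv_EE_eq {f : ℝ → ℂ} (hf : Nice f) {r : ℝ} (hr : 0 < r) :
    cv f EE r = cv f psi r - (√Real.pi / 2 : ℂ) * (r:ℂ)⁻¹ * mellin f 1 := by
  have i1 := cv_integrable hf psi_cont (a := 1) (by norm_num) psi_PB1 hr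
  have i3 := cv_integrable hf (inv_contOn (√Real.pi / 2 : ℂ)) (a := 1) (by norm_num)
    (inv_PB.const_mul _) hr
  rw [← cv_inv, cv, cv, cv, ← integral_sub i1 i3]
  congr 1
  ext u
  rw [EE_eq]
  ring

lemma cv_psi_contOn {f : ℝ → ℂ} (hf : Nice f) : ContinuousOn (cv f psi) (Ioi 0) := by
  have h1 := cv_continuousOn hf TT_cont TT_PB0
  refine ContinuousOn.congr (((h1.sub (continuousOn_const (c := 1/2 * mellin f 0))).add
    ((inv_contOn (√Real.pi / 2 : ℂ)).mul (continuousOn_const (c := mellin f 1))))) ?_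
  intro r hr
  exact cv_psi_eq hf hr

lemma gs_mul_gs (a b : ℝ) {r : ℝ} (hr : 0 < r) :
    gs (a * r) * gs (b * r) = gs (√(a ^ 2 + b ^ 2) * r) := by
  rw [gs, gs, gs, ← Complex.ofReal_mul, ← Real.exp_add]
  congr 2
  rw [mul_pow, mul_pow, mul_pow, Real.sq_sqrt (by positivity)]
  ring

lemma sqrt_cpow {D : ℝ} (hD : 0 < D) (s : ℂ) : ((√D : ℝ) : ℂ) ^ s = (D : ℂ) ^ (s / 2) := by
  have h : (0:ℝ) < √D := Real.sqrt_pos.mpr hD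
  have e : (D:ℂ) = ((√D : ℝ) : ℂ) ^ 2 := by
    rw [← Complex.ofReal_pow, Real.sq_sqrt hD.le]
  rw [e, ← Complex.cpow_nat_mul']
  · push_cast; congr 1; ring
  · rw [Complex.arg_ofReal_of_nonneg h.le]; simp [Real.pi_pos]
  · rw [Complex.arg_ofReal_of_nonneg h.le]; simp [Real.pi_pos.le]

lemma inner_r {s : ℂ} (hs : 0 < s.re) {x n u v : ℝ} (hx : 0 < x) (hn : 0 < n) (hu : 0 < u)
    (hv : 0 < v) :
    ∫ r in Ioi (0:ℝ), (r:ℂ) ^ (s - 1) * (gs (x * r / u) * gs (n * r / v)) =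
      ((u * v : ℝ) : ℂ) ^ s / ((n ^ 2 * u ^ 2 + x ^ 2 * v ^ 2 : ℝ) : ℂ) ^ (s / 2) *
        (Complex.Gamma (s / 2) / 2) := by
  set D : ℝ := n ^ 2 * u ^ 2 + x ^ 2 * v ^ 2 with hD
  have hD0 : 0 < D := by positivity
  have hc : √((x / u) ^ 2 + (n / v) ^ 2) = √D / (u * v) := by
    have : (x / u) ^ 2 + (n / v) ^ 2 = D / (u * v) ^ 2 := by rw [hD]; field_simp; ring
    rw [this, Real.sqrt_div' _ (by positivity), Real.sqrt_sq (by positivity)]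
  have h := mellin_comp_mul_left gs s (a := √D / (u * v)) (by positivity)
  rw [(mellin_gs hs).2, mellin] at h
  have e : ∀ r ∈ Ioi (0:ℝ), (r:ℂ) ^ (s - 1) * (gs (x * r / u) * gs (n * r / v)) =
      (r:ℂ) ^ (s - 1) • gs (√D / (u * v) * r) := by
    intro r hr
    rw [← hc, ← gs_mul_gs _ _ hr, smul_eq_mul, mul_div_right_comm, mul_div_right_comm]
  rw [setIntegral_congr_fun measurableSet_Ioi e, h, smul_eq_mul]
  congr 1
  rw [div_eq_mul_inv (√D), Complex.ofReal_mul, Complex.mul_cpow_ofReal_nonneg (by positivity) (by positivity),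
    sqrt_cpow hD0, neg_div, Complex.cpow_neg, Complex.ofReal_inv, Complex.inv_cpow, Complex.cpow_neg, inv_inv]
  · ring
  · rw [Complex.arg_ofReal_of_nonneg (by positivity)]; exact Real.pi_pos.ne

/-- triple integral kernel -/
lemma gs_sep {x a : ℝ} (hx : 0 < x) (ha : 0 ≤ a) : ∃ D : ℝ, 0 ≤ D ∧ ∀ u r : ℝ, 0 < u → 0 < r →
    ‖gs (x * r / u)‖ ≤ D * (1 + u ^ a) * min 1 (r ^ (-a)) := by
  obtain ⟨C, hC, h⟩ := gs_PB ha
  refine ⟨1 + C * x ^ (-a), by positivity, fun u r hu hr => ?_⟩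
  have h1 := h (x * r / u) (by positivity)
  have h0 : ‖gs (x * r / u)‖ ≤ 1 := by
    rw [gs_norm]; apply Real.exp_le_one_iff.mpr; nlinarith [sq_nonneg (x * r / u)]
  rw [Real.div_rpow (by positivity) hu.le, Real.mul_rpow hx.le hr.le, Real.rpow_neg hu.le,
    div_inv_eq_mul] at h1
  have p1 : 0 ≤ u ^ a := by positivity
  have p2 : 0 ≤ x ^ (-a) := by positivity
  have p3 : 0 ≤ r ^ (-a) := by positivity
  rcases min_choice 1 (r ^ (-a)) with hm | hm
  · rw [hm]
    have : 0 ≤ C * x ^ (-a) := by positivity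
    nlinarith [mul_nonneg this p1]
  · rw [hm]
    refine h1.trans ?_
    have q1 : 0 ≤ C * x ^ (-a) * r ^ (-a) := by positivity
    have q2 : 0 ≤ u ^ a * r ^ (-a) := by positivity
    nlinarith

theorem triple {f g : ℝ → ℂ} (hf : Nice f) (hg : Nice g) {s : ℂ} (hs : 0 < s.re) {x n : ℝ}
    (hx : 0 < x) (hn : 0 < n) :
    mellin (fun r => cv f gs (x * r) * cv g gs (n * r)) s = (Complex.Gamma (s / 2) / 2) *
      ∫ u in Ioi (0:ℝ), ∫ v in Ioi (0:ℝ), ((u * v : ℝ) : ℂ) ^ (s - 1) * (f u * g v) /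
        ((n ^ 2 * u ^ 2 + x ^ 2 * v ^ 2 : ℝ) : ℂ) ^ (s / 2) := by
  set μ : Measure ℝ := volume.restrict (Ioi (0:ℝ)) with hμ
  set K : ℝ × (ℝ × ℝ) → ℂ := fun q => (q.1 : ℂ) ^ (s - 1) *
    ((f q.2.1 * gs (x * q.1 / q.2.1) / q.2.1) * (g q.2.2 * gs (n * q.1 / q.2.2) / q.2.2)) with hK
  have hcont : ContinuousOn K (Ioi 0 ×ˢ (Ioi 0 ×ˢ Ioi 0)) := by
    intro q hq
    have hq1 : 0 < q.1 := hq.1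
    have hq2 : 0 < q.2.1 := hq.2.1
    have hq3 : 0 < q.2.2 := hq.2.2
    refine ContinuousAt.continuousWithinAt ?_
    have e1 : ContinuousAt (fun q : ℝ × (ℝ × ℝ) => (q.1 : ℂ) ^ (s - 1)) q :=
      ContinuousAt.comp (f := fun q : ℝ × (ℝ × ℝ) => q.1) (g := fun x : ℝ => (x:ℂ) ^ (s - 1))
        (continuousAt_ofReal_cpow_const _ _ (Or.inr hq1.ne')) continuous_fst.continuousAt
    have e2 : ContinuousAt (fun q : ℝ × (ℝ × ℝ) => f q.2.1) q :=
      ContinuousAt.comp (f := fun q : ℝ × (ℝ × ℝ) => q.2.1) (hf.1.continuousAt (Ioi_mem_nhds hq2))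
        (by fun_prop)
    have e3 : ContinuousAt (fun q : ℝ × (ℝ × ℝ) => g q.2.2) q :=
      ContinuousAt.comp (f := fun q : ℝ × (ℝ × ℝ) => q.2.2) (hg.1.continuousAt (Ioi_mem_nhds hq3))
        (by fun_prop)
    have e4 : ContinuousAt (fun q : ℝ × (ℝ × ℝ) => gs (x * q.1 / q.2.1)) q :=
      ContinuousAt.comp (f := fun q : ℝ × (ℝ × ℝ) => x * q.1 / q.2.1) gs_cont.continuousAt
        (ContinuousAt.div (by fun_prop) (by fun_prop) hq2.ne')
    have e5 : ContinuousAt (fun q : ℝ × (ℝ × ℝ) => gs (n * q.1 / q.2.2)) q :=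
      ContinuousAt.comp (f := fun q : ℝ × (ℝ × ℝ) => n * q.1 / q.2.2) gs_cont.continuousAt
        (ContinuousAt.div (by fun_prop) (by fun_prop) hq3.ne')
    refine e1.mul (((e2.mul e4).div (by fun_prop) ?_).mul ((e3.mul e5).div (by fun_prop) ?_))
    · simpa using hq2.ne'
    · simpa using hq3.ne'
  have hmeas : AEStronglyMeasurable K (μ.prod (μ.prod μ)) := by
    rw [hμ, Measure.prod_restrict, Measure.prod_restrict]
    exact hcont.aestronglyMeasurable (measurableSet_Ioi.prod (measurableSet_Ioi.prod measurableSet_Ioi))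
  set a : ℝ := s.re + 1 with ha
  obtain ⟨D, hD, hsep⟩ := gs_sep (a := a) hx (by linarith)
  have hm : Integrable (fun r : ℝ => r ^ (s.re - 1) * min 1 (r ^ (-a))) μ := by
    have c1 : ContinuousOn (fun r : ℝ => ((min 1 (r ^ (-a)) : ℝ) : ℂ)) (Ioi 0) := by
      refine Continuous.comp_continuousOn (g := fun t : ℝ => ((min 1 t : ℝ) : ℂ)) (by fun_prop) ?_
      intro r hr
      exact (Real.continuousAt_rpow_const _ _ (Or.inl (ne_of_gt hr))).continuousWithinAt
    have nn : ∀ y : ℝ, 0 < y → ‖((min 1 (y ^ (-a)) : ℝ) : ℂ)‖ = min 1 (y ^ (-a)) := by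
      intro y hy
      rw [Complex.norm_real, Real.norm_of_nonneg]
      exact le_min zero_le_one (by positivity)
    have b1 : PB (fun r : ℝ => ((min 1 (r ^ (-a)) : ℝ) : ℂ)) 0 := ⟨1, zero_le_one, fun y hy => by
      rw [nn y hy]; simp⟩
    have b2 : PB (fun r : ℝ => ((min 1 (r ^ (-a)) : ℝ) : ℂ)) a := ⟨1, zero_le_one, fun y hy => by
      rw [nn y hy]; simp⟩
    have := (PB.mellinConvergent c1 b2 b1 hs (by rw [ha]; linarith)).norm'
    refine this.congr ?_
    filter_upwards [ae_restrict_mem measurableSet_Ioi] with r hr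
    rw [nn r hr]
  have hfi : Integrable (fun u : ℝ => u ^ ((0:ℝ) - 1) * ‖f u‖ + u ^ (a - 1) * ‖f u‖) μ :=
    (hf.absInt (by norm_num)).add (hf.absInt (by linarith))
  have hgi : Integrable (fun u : ℝ => u ^ ((0:ℝ) - 1) * ‖g u‖) μ := hg.absInt (by norm_num)
  have hIntg : Integrable K (μ.prod (μ.prod μ)) := by
    refine ((hm.mul_prod (hfi.mul_prod hgi)).const_mul D).mono' hmeas ?_
    have hae : ∀ᵐ q ∂(μ.prod (μ.prod μ)), q ∈ Ioi (0:ℝ) ×ˢ (Ioi (0:ℝ) ×ˢ Ioi (0:ℝ)) := by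
      rw [hμ, Measure.prod_restrict, Measure.prod_restrict]
      exact ae_restrict_mem (measurableSet_Ioi.prod (measurableSet_Ioi.prod measurableSet_Ioi))
    filter_upwards [hae] with q hq
    obtain ⟨r, u, v⟩ := q
    have hr : 0 < r := hq.1
    have hu : 0 < u := hq.2.1
    have hv : 0 < v := hq.2.2
    have h0 : ‖gs (n * r / v)‖ ≤ 1 := by
      rw [gs_norm]; apply Real.exp_le_one_iff.mpr; nlinarith [sq_nonneg (n * r / v)]
    have h1 := hsep u r hu hr
    simp only [hK, norm_mul, norm_div, norm_ofReal_cpow_pos hr, Complex.norm_real,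
      Real.norm_of_nonneg hu.le, Real.norm_of_nonneg hv.le]
    have e1 : u ^ ((0:ℝ) - 1) = u⁻¹ := by rw [zero_sub, Real.rpow_neg_one]
    have e2 : v ^ ((0:ℝ) - 1) = v⁻¹ := by rw [zero_sub, Real.rpow_neg_one]
    have e3 : u ^ (a - 1) = u ^ a * u⁻¹ := by rw [Real.rpow_sub_one hu.ne']; ring
    have e4 : (s - 1).re = s.re - 1 := by simp
    rw [e1, e2, e3, e4]
    have hp : 0 ≤ min 1 (r ^ (-a)) := le_min zero_le_one (by positivity)
    calc r ^ (s.re - 1) * (‖f u‖ * ‖gs (x * r / u)‖ / u * (‖g v‖ * ‖gs (n * r / v)‖ / v))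
        ≤ r ^ (s.re - 1) * (‖f u‖ * (D * (1 + u ^ a) * min 1 (r ^ (-a))) / u * (‖g v‖ * 1 / v)) := by
          gcongr
      _ = _ := by field_simp
  have s1 : mellin (fun r => cv f gs (x * r) * cv g gs (n * r)) s =
      ∫ r, ∫ q, K (r, q) ∂(μ.prod μ) ∂μ := by
    rw [mellin]
    refine integral_congr_ae (Eventually.of_forall fun r => ?_)
    simp only [hK, smul_eq_mul]
    rw [integral_const_mul, integral_prod_mul (fun u : ℝ => f u * gs (x * r / u) / u)
      (fun v : ℝ => g v * gs (n * r / v) / v)]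
    rfl
  rw [s1, integral_integral_swap (f := fun r q => K (r, q)) hIntg, integral_prod _ hIntg.integral_prod_right,
    ← integral_const_mul]
  refine setIntegral_congr_fun measurableSet_Ioi fun u hu => ?_
  have hu' : (0:ℝ) < u := hu
  rw [← integral_const_mul]
  refine setIntegral_congr_fun measurableSet_Ioi fun v hv => ?_
  have hv' : (0:ℝ) < v := hv
  have huv : ((u * v : ℝ) : ℂ) ≠ 0 := by exact_mod_cast (mul_pos hu' hv').ne'
  have e : ∀ r : ℝ, K (r, (u, v)) = (f u * g v / ((u * v : ℝ) : ℂ)) *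
      ((r:ℂ) ^ (s - 1) * (gs (x * r / u) * gs (n * r / v))) := by
    intro r
    simp only [hK]
    push_cast
    field_simp
  simp only [e]
  rw [integral_const_mul, inner_r hs hx hn hu' hv', Complex.cpow_sub _ _ huv, Complex.cpow_one]
  ring

/-- the sine kernel -/
def Qw (w : ℂ) (v : ℝ) : ℂ := gs v * Complex.sin (w * v)

lemma Qw_eq (w : ℂ) : Qw w = fun v => -I * Sw (I * w) v := by
  ext v
  have h : Complex.sinh (I * w * v) = Complex.sin (w * v) * I := by
    rw [← Complex.sinh_mul_I]; congr 1; ring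
  rw [Qw, Sw, h]
  linear_combination gs v * Complex.sin (w * v) * Complex.I_mul_I

lemma Qw_nice (w : ℂ) : Nice (Qw w) := by
  rw [Qw_eq]; exact (Sw_nice _).const_mul _

theorem mellin_Qw (w : ℂ) {p : ℂ} (hp : -1 < p.re) :
    mellin (Qw w) p = (w / 2) * Complex.Gamma ((p + 1) / 2) *
      oneF1 ((p + 1) / 2) (3/2) (-(w ^ 2 / 4)) := by
  have h := mellin_const_smul (Sw (I * w)) p (-I)
  simp only [smul_eq_mul] at h
  rw [Qw_eq, h, mellin_Sw _ hp, mul_pow, Complex.I_sq, show -1 * w ^ 2 / 4 = -(w^2/4) by ring]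
  linear_combination (-(w / 2) * Complex.Gamma ((p + 1) / 2) *
      oneF1 ((p + 1) / 2) (3/2) (-(w ^ 2 / 4))) * Complex.I_mul_I

lemma sqrtpi_ne : ((√Real.pi : ℝ) : ℂ) ≠ 0 := by
  exact_mod_cast (Real.sqrt_pos.mpr Real.pi_pos).ne'

lemma Gamma_half_sqrt : Complex.Gamma (1/2) = ((√Real.pi : ℝ) : ℂ) := by
  rw [Complex.Gamma_one_half_eq, Real.sqrt_eq_rpow, Complex.ofReal_cpow Real.pi_pos.le]
  norm_num

lemma mellin_Qw_zero (w : ℂ) :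
    mellin (Qw w) 0 = (w / 2) * ((√Real.pi : ℝ) : ℂ) * oneF1 (1/2) (3/2) (-(w ^ 2 / 4)) := by
  rw [mellin_Qw w (by simp), zero_add, Gamma_half_sqrt]

lemma mellin_Qw_one (w : ℂ) :
    mellin (Qw w) 1 = (w / 2) * oneF1 1 (3/2) (-(w ^ 2 / 4)) := by
  rw [mellin_Qw w (by simp), show (1 + 1 : ℂ) / 2 = 1 by norm_num, Complex.Gamma_one, mul_one]

lemma mellin_Sw_one (w : ℂ) :
    mellin (Sw w) 1 = (w / 2) * oneF1 1 (3/2) (w ^ 2 / 4) := by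
  rw [mellin_Sw w (by simp), show (1 + 1 : ℂ) / 2 = 1 by norm_num, Complex.Gamma_one, mul_one]

lemma Afun_eq {w : ℂ} (hw : w ≠ 0) (z : ℂ) :
    Afun w z = oneF1 (1/2) (3/2) (-(w ^ 2 / 4)) * oneF1 (1 + z / 2) (3/2) (w ^ 2 / 4) := by
  rw [Afun, cerf_eq]
  have := sqrtpi_ne
  rw [show -(w / 2) ^ 2 = -(w ^ 2 / 4) by ring]
  field_simp

lemma Afun_I_eq {w : ℂ} (hw : w ≠ 0) (z : ℂ) :
    Afun (I * w) (-z) = oneF1 1 (3/2) (-(w ^ 2 / 4)) * oneF1 ((z + 1) / 2) (3/2) (w ^ 2 / 4) := by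
  rw [Afun_eq (mul_ne_zero Complex.I_ne_zero hw), mul_pow, Complex.I_sq,
    show -(-1 * w ^ 2 / 4) = w ^ 2 / 4 by ring, show -1 * w ^ 2 / 4 = -(w ^ 2 / 4) by ring]
  have h1 := kummer 1 (w ^ 2 / 4)
  have h2 := kummer ((z + 1) / 2) (-(w ^ 2 / 4))
  rw [neg_neg] at h2
  rw [show (3/2 - 1 : ℂ) = 1/2 by norm_num] at h1
  rw [show 3/2 - (z + 1) / 2 = 1 + -z / 2 by ring] at h2
  rw [← h1, ← h2, Complex.exp_neg]
  have := Complex.exp_ne_zero (w ^ 2 / 4)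
  field_simp

/-- the constant -/
def Cs (w s : ℂ) : ℂ :=
  8 / (w ^ 2 * ((√Real.pi : ℝ) : ℂ)) * ((Complex.Gamma ((s + 1) / 2))⁻¹ * (Complex.Gamma (s / 2))⁻¹)

lemma cvgs_PB {f : ℝ → ℂ} (hf : Nice f) {a : ℝ} (ha : 0 ≤ a) : PB (cv f gs) a :=
  PB.cv hf (by linarith) (gs_PB ha)

lemma cvgs_cont {f : ℝ → ℂ} (hf : Nice f) : ContinuousOn (cv f gs) (Ioi 0) :=
  cv_continuousOn hf gs_cont.continuousOn (gs_PB le_rfl)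

lemma cvgs_mellin {f : ℝ → ℂ} (hf : Nice f) {x : ℝ} (hx : 0 < x) {s : ℂ} (hs : 0 < s.re) :
    HasMellin (fun r => cv f gs (x * r)) s ((x:ℂ) ^ (-s) * (mellin f s * (Complex.Gamma (s / 2) / 2))) := by
  have h := hasMellin_cv hf.1 gs_cont.continuousOn (hf.mellinConvergent (by linarith))
    (mellin_gs hs).1
  rw [(mellin_gs hs).2] at h
  refine ⟨(MellinConvergent.comp_mul_left hx).mpr h.1, ?_⟩
  rw [mellin_comp_mul_left _ _ hx, h.2, smul_eq_mul]

theorem zetaW_eq {w : ℂ} {s : ℂ} (hs : 1 < s.re) {x : ℝ} (hx : 0 < x) :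
    zetaW w s (x + 1) = Cs w s * mellin (fun r => cv (Sw w) gs (x * r) * cv (Qw w) psi r) s := by
  have hP := Sw_nice w
  have hQ := Qw_nice w
  have hG : Complex.Gamma (s / 2) ≠ 0 := Complex.Gamma_ne_zero_of_re_pos (by simp; linarith)
  set a : ℝ := (1 + s.re) / 2 with ha
  have h := sumM (A := cv (Qw w) gs) (H := fun r => cv (Sw w) gs (x * r)) (a := a) (s := s)
    (by rw [ha]; linarith) (cvgs_cont hQ) (cvgs_PB hQ (by rw [ha]; linarith))
    (comp_mul_contOn (cvgs_cont hP) hx) (by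
      have := (cvgs_mellin hP hx (s := ((s.re - a : ℝ) : ℂ)) (by rw [Complex.ofReal_re, ha]; linarith)).1.norm'
      simpa only [Complex.ofReal_re] using this)
  have e1 : mellin (fun r => cv (Sw w) gs (x * r) * cv (Qw w) psi r) s =
      mellin (fun r => (∑' k : ℕ+, cv (Qw w) gs (k * r)) * cv (Sw w) gs (x * r)) s := by
    rw [mellin, mellin]
    refine setIntegral_congr_fun measurableSet_Ioi fun r hr => ?_
    rw [(cv_psi_hasSum hQ hr).tsum_eq, mul_comm (cv (Sw w) gs (x * r))]
  rw [e1, ← h.tsum_eq, zetaW, Cs]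
  have e2 : ∀ n : ℕ+, (∫ u in Ioi (0:ℝ), ∫ v in Ioi (0:ℝ),
      ((u * v : ℝ) : ℂ) ^ (s - 1) * Complex.exp (-((u:ℂ) ^ 2 + (v:ℂ) ^ 2)) *
        Complex.sin (w * v) * Complex.sinh (w * u) /
        (((n:ℂ) ^ 2 * (u:ℂ) ^ 2 + (((x + 1 : ℝ):ℂ) - 1) ^ 2 * (v:ℂ) ^ 2)) ^ (s / 2)) =
      2 * (Complex.Gamma (s / 2))⁻¹ * mellin (fun r => cv (Qw w) gs (n * r) * cv (Sw w) gs (x * r)) s := by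
    intro n
    have h3 := triple hP hQ (s := s) (by linarith) hx (pnat_pos n)
    have h4 : mellin (fun r => cv (Qw w) gs (n * r) * cv (Sw w) gs (x * r)) s =
      mellin (fun r => cv (Sw w) gs (x * r) * cv (Qw w) gs (n * r)) s := by
      congr 1; ext r; ring
    rw [h4, h3, ← mul_assoc, show 2 * (Complex.Gamma (s / 2))⁻¹ * (Complex.Gamma (s / 2) / 2) = 1 by
      field_simp, one_mul]
    congr 1; ext u; congr 1; ext v
    rw [Sw, Qw, gs, gs]
    push_cast
    rw [add_sub_cancel_right, neg_add, Complex.exp_add]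
    ring
  rw [tsum_congr e2, tsum_mul_left]
  simp only [div_eq_mul_inv, mul_inv]
  ring

lemma Gamma_half_diff {s : ℂ} (h : ∀ m : ℕ, s / 2 ≠ -m) :
    DifferentiableAt ℂ (fun q => Complex.Gamma (q / 2)) s :=
  DifferentiableAt.comp (g := Complex.Gamma) (f := fun q => q / 2) s
    (Complex.differentiableAt_Gamma _ h) (by fun_prop)

lemma half_ne {s : ℂ} (hs : 0 < s.re) (m : ℕ) : s / 2 ≠ -m := by
  intro h
  have := congrArg Complex.re h
  simp at this
  have hm : (0:ℝ) ≤ m := m.cast_nonneg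
  linarith

lemma half_sub_ne {s : ℂ} (hs : 0 < s.re) (hs1 : s ≠ 1) (m : ℕ) : (s - 1) / 2 ≠ -m := by
  intro h
  rcases Nat.eq_zero_or_pos m with rfl | hm
  · simp at h; exact hs1 (by linear_combination h)
  · have := congrArg Complex.re h
    simp at this
    have hm : (1:ℝ) ≤ m := by exact_mod_cast hm
    linarith

lemma Cs_diff (w s : ℂ) : DifferentiableAt ℂ (Cs w) s := by
  unfold Cs
  have h := Complex.differentiable_one_div_Gamma
  refine DifferentiableAt.const_mul (DifferentiableAt.mul ?_ ?_) _
  · exact DifferentiableAt.comp (g := fun s => (Complex.Gamma s)⁻¹) (f := fun s => (s + 1) / 2) s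
      (h _) (by fun_prop)
  · exact DifferentiableAt.comp (g := fun s => (Complex.Gamma s)⁻¹) (f := fun s => s / 2) s
      (h _) (by fun_prop)

lemma mellin_inv_mul (f : ℝ → ℂ) (s : ℂ) :
    mellin (fun r => (r:ℂ)⁻¹ * f r) s = mellin f (s - 1) := by
  have := mellin_cpow_smul f s (-1)
  rw [← sub_eq_add_neg] at this
  rw [← this]
  congr 1; ext r; rw [smul_eq_mul, cpow_neg_one]

lemma mellinConv_inv_mul {f : ℝ → ℂ} {s : ℂ} (h : MellinConvergent f (s - 1)) :
    MellinConvergent (fun r => (r:ℂ)⁻¹ * f r) s := by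
  have := (MellinConvergent.cpow_smul (f := f) (s := s) (a := -1)).mpr (by
    rw [← sub_eq_add_neg]; exact h)
  refine (this.congr_fun ?_ measurableSet_Ioi)
  intro r _
  simp only [smul_eq_mul, cpow_neg_one]

lemma TTprod_PB {w : ℂ} {x : ℝ} (hx : 0 < x) {a : ℝ} (ha : 0 ≤ a) :
    PB (fun r => cv (Sw w) gs (x * r) * cv (Qw w) TT r) a := by
  have := ((cvgs_PB (Sw_nice w) ha).comp_mul hx).mul (PB.cv (Qw_nice w) (by norm_num) TT_PB0)
  simpa using this

lemma TTprod_cont {w : ℂ} {x : ℝ} (hx : 0 < x) :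
    ContinuousOn (fun r => cv (Sw w) gs (x * r) * cv (Qw w) TT r) (Ioi 0) :=
  (comp_mul_contOn (cvgs_cont (Sw_nice w)) hx).mul (cv_continuousOn (Qw_nice w) TT_cont TT_PB0)

theorem F_eq {w : ℂ} {x : ℝ} (hx : 0 < x) (F : ℂ → ℂ)
    (hF : DifferentiableOn ℂ F {s : ℂ | -1 < s.re ∧ s ≠ 1})
    (hFeq : ∀ s : ℂ, 1 < s.re → F s = zetaW w s (x + 1)) {s : ℂ} (h0 : 0 < s.re) (h2 : s.re < 2)
    (h1 : s ≠ 1) :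
    F s = Cs w s * (mellin (fun r => cv (Sw w) gs (x * r) * cv (Qw w) TT r) s
      - 1/2 * mellin (Qw w) 0 * ((x:ℂ) ^ (-s) * (mellin (Sw w) s * (Complex.Gamma (s / 2) / 2)))
      + (√Real.pi / 2 : ℂ) * mellin (Qw w) 1 *
        ((x:ℂ) ^ (-(s - 1)) * (mellin (Sw w) (s - 1) * (Complex.Gamma ((s - 1) / 2) / 2)))) := by
  have hx0 : (x:ℂ) ≠ 0 := by exact_mod_cast hx.ne'
  have hP := Sw_nice w
  have hQ := Qw_nice w
  refine ident_strip (f := F) (g := fun s => Cs w s *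
    (mellin (fun r => cv (Sw w) gs (x * r) * cv (Qw w) TT r) s
      - 1/2 * mellin (Qw w) 0 * ((x:ℂ) ^ (-s) * (mellin (Sw w) s * (Complex.Gamma (s / 2) / 2)))
      + (√Real.pi / 2 : ℂ) * mellin (Qw w) 1 *
        ((x:ℂ) ^ (-(s - 1)) * (mellin (Sw w) (s - 1) * (Complex.Gamma ((s - 1) / 2) / 2)))))
    (a := 0) (b := 2) (by norm_num) (by norm_num) ?_ ?_ ?_ h0 h2 h1
  · intro s hs _ hs1
    refine hF.differentiableAt (IsOpen.mem_nhds ?_ ⟨by linarith, hs1⟩)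
    exact (isOpen_lt continuous_const Complex.continuous_re).inter isOpen_ne
  · intro s hs _ hs1
    have d1 : DifferentiableAt ℂ (mellin (fun r => cv (Sw w) gs (x * r) * cv (Qw w) TT r)) s :=
      PB.mellinDiff (TTprod_cont hx) (TTprod_PB hx (a := s.re + 1) (by linarith))
        (TTprod_PB hx (a := 0) le_rfl) hs (by linarith)
    have d2 : DifferentiableAt ℂ (mellin (Sw w)) s := hP.mellinDiff (by linarith)
    have d3 : DifferentiableAt ℂ (fun s => mellin (Sw w) (s - 1)) s :=
      DifferentiableAt.comp (g := mellin (Sw w)) (f := fun s => s - 1) s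
        (hP.mellinDiff (by simp; linarith)) (by fun_prop)
    have d4 := Gamma_half_diff (half_ne hs)
    have d5 : DifferentiableAt ℂ (fun s => Complex.Gamma ((s - 1) / 2)) s :=
      DifferentiableAt.comp (g := fun q => Complex.Gamma (q / 2)) (f := fun s => s - 1) s
        (Gamma_half_diff (half_sub_ne hs hs1)) (by fun_prop)
    have d6 : DifferentiableAt ℂ (fun s => (x:ℂ) ^ (-s)) s :=
      DifferentiableAt.const_cpow (by fun_prop) (Or.inl hx0)
    have d7 : DifferentiableAt ℂ (fun s => (x:ℂ) ^ (-(s - 1))) s :=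
      DifferentiableAt.const_cpow (by fun_prop) (Or.inl hx0)
    exact (Cs_diff w s).mul ((d1.sub ((d6.mul (d2.mul (d4.div_const _))).const_mul _)).add
      ((d7.mul (d3.mul (d5.div_const _))).const_mul _))
  · intro s hs _
    rw [hFeq s hs, zetaW_eq hs hx]
    congr 1
    have m1 : MellinConvergent (fun r => cv (Sw w) gs (x * r) * cv (Qw w) TT r) s :=
      PB.mellinConvergent (TTprod_cont hx) (TTprod_PB hx (a := s.re + 1) (by linarith))
        (TTprod_PB hx (a := 0) le_rfl) (by linarith) (by linarith)
    have m2 := cvgs_mellin hP hx (s := s) (by linarith)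
    have m3 := cvgs_mellin hP hx (s := s - 1) (by simp; linarith)
    have m2' := m2.1.const_smul (1/2 * mellin (Qw w) 0)
    have m3' := (mellinConv_inv_mul m3.1).const_smul ((√Real.pi / 2 : ℂ) * mellin (Qw w) 1)
    have k1 := hasMellin_sub m1 m2'
    have k2 := hasMellin_add k1.1 m3'
    rw [← m2.2, ← m3.2, ← mellin_inv_mul, ← smul_eq_mul (1/2 * mellin (Qw w) 0), ← smul_eq_mul (_ * mellin (Qw w) 1),
      ← mellin_const_smul, ← mellin_const_smul, ← k1.2, ← k2.2]
    rw [mellin, mellin]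
    refine setIntegral_congr_fun measurableSet_Ioi fun r hr => ?_
    simp only [smul_eq_mul]
    rw [cv_psi_eq hQ hr]
    ring

lemma Gamma_z_half {z : ℂ} (hz0 : z ≠ 0) :
    Complex.Gamma (z / 2 + 1) = z / 2 * Complex.Gamma (z / 2) :=
  Complex.Gamma_add_one _ (div_ne_zero hz0 two_ne_zero)

lemma Gamma_z_ne {z : ℂ} (hz1 : -1 < z.re) : Complex.Gamma (z / 2 + 1) ≠ 0 :=
  Complex.Gamma_ne_zero_of_re_pos (by simp; linarith)

lemma Gamma_z_ne2 {z : ℂ} (hz1 : -1 < z.re) : Complex.Gamma ((z + 1) / 2) ≠ 0 :=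
  Complex.Gamma_ne_zero_of_re_pos (by simp; linarith)

lemma Gamma_z_ne3 {z : ℂ} (hz1 : -1 < z.re) (hz0 : z ≠ 0) : Complex.Gamma (z / 2) ≠ 0 := by
  have := Gamma_z_ne hz1
  rw [Gamma_z_half hz0] at this
  exact right_ne_zero_of_mul this

theorem phi_eq {w : ℂ} (hw : w ≠ 0) {x : ℝ} (hx : 0 < x) (F : ℂ → ℂ)
    (hF : DifferentiableOn ℂ F {s : ℂ | -1 < s.re ∧ s ≠ 1})
    (hFeq : ∀ s : ℂ, 1 < s.re → F s = zetaW w s (x + 1)) {z : ℂ} (hz1 : -1 < z.re) (hz2 : z.re < 1)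
    (hz0 : z ≠ 0) :
    F (z + 1) + Afun w z * (x : ℂ) ^ (-z - 1) / 2 - Afun (I * w) (-z) * (x : ℂ) ^ (-z) / z =
     Cs w (z + 1) * mellin (fun r => cv (Sw w) gs (x * r) * cv (Qw w) TT r) (z + 1) := by
  have h := F_eq (w := w) hx F hF hFeq (s := z + 1) (by simp; linarith) (by simp; linarith)
    (by simpa using hz0)
  rw [h, Afun_eq hw, Afun_I_eq hw, mellin_Qw_zero, mellin_Qw_one, mellin_Sw _ (by simp; linarith),
    mellin_Sw _ (by simp; linarith), Cs]
  rw [show (z + 1 + 1) / 2 = z / 2 + 1 by ring, show (z + 1 - 1) / 2 = z / 2 by ring,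
    show z + 1 - 1 = z by ring, show -(z + 1) = -z - 1 by ring, Gamma_z_half hz0,
    show 1 + z / 2 = z / 2 + 1 by ring]
  have g1 := Gamma_z_ne2 hz1
  have g2 := Gamma_z_ne3 hz1 hz0
  have := sqrtpi_ne
  field_simp
  ring

lemma TTcv_PB (w : ℂ) {b : ℝ} (hb : -1 < b) (hb0 : b ≤ 0) : PB (cv (Qw w) TT) b :=
  PB.cv (Qw_nice w) hb (TT_PB hb.le hb0)

lemma TTcv_cont (w : ℂ) : ContinuousOn (cv (Qw w) TT) (Ioi 0) :=
  cv_continuousOn (Qw_nice w) TT_cont TT_PB0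

theorem sum_phi {w : ℂ} {α : ℝ} (hα : 0 < α) {s : ℂ} (h0 : 0 < s.re) :
    ∑' m : ℕ+, mellin (fun r => cv (Sw w) gs ((m * α) * r) * cv (Qw w) TT r) s =
      mellin (fun r => cv (Sw w) psi (α * r) * cv (Qw w) TT r) s := by
  have hP := Sw_nice w
  set M := max 1 s.re with hM
  have hM1 : 1 ≤ M := le_max_left _ _
  have hM2 : s.re ≤ M := le_max_right _ _
  have hM3 : M < s.re + 1 := max_lt (by linarith) (by linarith)
  set a : ℝ := (M + (s.re + 1)) / 2 with ha
  have ha1 : M < a := by rw [ha]; linarith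
  have ha2 : a < s.re + 1 := by rw [ha]; linarith
  have h := sumM (A := fun r => cv (Sw w) gs (α * r)) (H := cv (Qw w) TT) (a := a) (s := s)
    (by linarith) (comp_mul_contOn (cvgs_cont hP) hα) ((cvgs_PB hP (by linarith)).comp_mul hα)
    (TTcv_cont w) (by
      have := (PB.mellinConvergent (TTcv_cont w) (TTcv_PB w (b := 0) (by norm_num) le_rfl)
        (TTcv_PB w (b := (s.re - a - 1) / 2) (by linarith) (by linarith))
        (s := ((s.re - a : ℝ) : ℂ)) (by rw [Complex.ofReal_re]; linarith)
        (by rw [Complex.ofReal_re]; linarith)).norm'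
      simpa only [Complex.ofReal_re] using this)
  have e1 : mellin (fun r => cv (Sw w) psi (α * r) * cv (Qw w) TT r) s =
      mellin (fun r => (∑' k : ℕ+, cv (Sw w) gs (α * (k * r))) * cv (Qw w) TT r) s := by
    rw [mellin, mellin]
    refine setIntegral_congr_fun measurableSet_Ioi fun r hr => ?_
    have := (cv_psi_hasSum hP (mul_pos hα hr)).tsum_eq
    simp only [mul_left_comm α, ← this]
  rw [e1, ← h.tsum_eq]
  refine tsum_congr fun m => ?_
  congr 1; ext r; rw [show m * α * r = α * (m * r) by ring]

lemma EEcv_PB {f : ℝ → ℂ} (hf : Nice f) {b : ℝ} (hb : 0 ≤ b) (hb0 : b ≤ 1) : PB (cv f EE) b :=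
  PB.cv hf (by linarith) (EE_PB hb hb0)

lemma EEcv_cont {f : ℝ → ℂ} (hf : Nice f) : ContinuousOn (cv f EE) (Ioi 0) :=
  cv_continuousOn hf EE_cont EE_PB0

lemma psicv_PB {f : ℝ → ℂ} (hf : Nice f) {b : ℝ} (hb : 1 ≤ b) : PB (cv f psi) b :=
  PB.cv hf (by linarith) (psi_PB hb)

lemma EEEE_conv {f g : ℝ → ℂ} (hf : Nice f) (hg : Nice g) {α : ℝ} (hα : 0 < α) {s : ℂ}
    (h0 : 0 < s.re) (h2 : s.re < 2) :
    MellinConvergent (fun r => cv f EE (α * r) * cv g EE r) s ∧ 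
    DifferentiableAt ℂ (mellin (fun r => cv f EE (α * r) * cv g EE r)) s := by
  have hc : ContinuousOn (fun r => cv f EE (α * r) * cv g EE r) (Ioi 0) :=
    (comp_mul_contOn (EEcv_cont hf) hα).mul (EEcv_cont hg)
  have p1 : PB (fun r => cv f EE (α * r) * cv g EE r) 2 := by
    have := ((EEcv_PB hf zero_le_one le_rfl).comp_mul hα).mul (EEcv_PB hg zero_le_one le_rfl)
    norm_num at this
    exact this
  have p2 : PB (fun r => cv f EE (α * r) * cv g EE r) 0 := by
    have := ((EEcv_PB hf le_rfl zero_le_one).comp_mul hα).mul (EEcv_PB hg le_rfl zero_le_one)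
    norm_num at this
    exact this
  exact ⟨PB.mellinConvergent hc p1 p2 h0 h2, PB.mellinDiff hc p1 p2 h0 h2⟩

lemma psiTT_conv (w : ℂ) {α : ℝ} (hα : 0 < α) {s : ℂ} (h0 : 0 < s.re) :
    MellinConvergent (fun r => cv (Sw w) psi (α * r) * cv (Qw w) TT r) s ∧ 
    DifferentiableAt ℂ (mellin (fun r => cv (Sw w) psi (α * r) * cv (Qw w) TT r)) s := by
  have hc : ContinuousOn (fun r => cv (Sw w) psi (α * r) * cv (Qw w) TT r) (Ioi 0) :=
    (comp_mul_contOn (cv_psi_contOn (Sw_nice w)) hα).mul (TTcv_cont w)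
  have p1 : PB (fun r => cv (Sw w) psi (α * r) * cv (Qw w) TT r) (s.re + 1) := by
    have := ((psicv_PB (Sw_nice w) (b := s.re + 1) (by linarith)).comp_mul hα).mul
      (TTcv_PB w (b := 0) (by norm_num) le_rfl)
    simpa using this
  set b := min s.re 1 / 2 with hb
  have hb0 : 0 < b := by rw [hb]; positivity
  have hb1 : b < s.re := by have := min_le_left s.re 1; rw [hb]; linarith
  have hb2 : b < 1 := by have := min_le_right s.re 1; rw [hb]; linarith
  have p2 : PB (fun r => cv (Sw w) psi (α * r) * cv (Qw w) TT r) b := by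
    have := ((psicv_PB (Sw_nice w) (b := 1) le_rfl).comp_mul hα).mul
      (TTcv_PB w (b := b - 1) (by linarith) (by linarith))
    simpa using this
  exact ⟨PB.mellinConvergent hc p1 p2 hb1 (by linarith), PB.mellinDiff hc p1 p2 hb1 (by linarith)⟩

theorem psiTT_eq (w : ℂ) {α : ℝ} (hα : 0 < α) {s : ℂ} (h0 : 0 < s.re) (h2 : s.re < 2) (h1 : s ≠ 1) :
    mellin (fun r => cv (Sw w) psi (α * r) * cv (Qw w) TT r) s =
      mellin (fun r => cv (Sw w) EE (α * r) * cv (Qw w) EE r) s +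
      1/2 * mellin (Qw w) 0 * ((α:ℂ) ^ (-s) * (mellin (Sw w) s *
        (Complex.Gamma (s / 2) * riemannZeta s / 2))) +
      (√Real.pi / 2 : ℂ) * (α:ℂ)⁻¹ * mellin (Sw w) 1 * (mellin (Qw w) (s - 1) *
        (Complex.Gamma ((s - 1) / 2) * riemannZeta (s - 1) / 2)) := by
  have hx0 : (α:ℂ) ≠ 0 := by exact_mod_cast hα.ne'
  have hP := Sw_nice w
  have hQ := Qw_nice w
  refine ident_strip (f := fun s => mellin (fun r => cv (Sw w) psi (α * r) * cv (Qw w) TT r) s)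
    (g := fun s => mellin (fun r => cv (Sw w) EE (α * r) * cv (Qw w) EE r) s +
      1/2 * mellin (Qw w) 0 * ((α:ℂ) ^ (-s) * (mellin (Sw w) s *
        (Complex.Gamma (s / 2) * riemannZeta s / 2))) +
      (√Real.pi / 2 : ℂ) * (α:ℂ)⁻¹ * mellin (Sw w) 1 * (mellin (Qw w) (s - 1) *
        (Complex.Gamma ((s - 1) / 2) * riemannZeta (s - 1) / 2)))
    (a := 0) (b := 2) (by norm_num) (by norm_num) ?_ ?_ ?_ h0 h2 h1
  · intro s hs _ hs1
    exact (psiTT_conv w hα hs).2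
  · intro s hs hs2 hs1
    have d1 := (EEEE_conv hP hQ hα hs hs2).2
    have d2 : DifferentiableAt ℂ (mellin (Sw w)) s := hP.mellinDiff (by linarith)
    have d3 : DifferentiableAt ℂ (fun s => mellin (Qw w) (s - 1)) s :=
      DifferentiableAt.comp (g := mellin (Qw w)) (f := fun s => s - 1) s
        (hQ.mellinDiff (by simp; linarith)) (by fun_prop)
    have d4 := Gamma_half_diff (half_ne hs)
    have d5 : DifferentiableAt ℂ (fun s => Complex.Gamma ((s - 1) / 2)) s :=
      DifferentiableAt.comp (g := fun q => Complex.Gamma (q / 2)) (f := fun s => s - 1) s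
        (Gamma_half_diff (half_sub_ne hs hs1)) (by fun_prop)
    have d6 : DifferentiableAt ℂ (fun s => (α:ℂ) ^ (-s)) s :=
      DifferentiableAt.const_cpow (by fun_prop) (Or.inl hx0)
    have d7 : DifferentiableAt ℂ riemannZeta s := differentiableAt_riemannZeta hs1
    have d8 : DifferentiableAt ℂ (fun s => riemannZeta (s - 1)) s :=
      DifferentiableAt.comp (g := riemannZeta) (f := fun s => s - 1) s
        (differentiableAt_riemannZeta (by
          intro h
          have h' : s = 2 := by linear_combination h
          rw [h'] at hs2; norm_num at hs2)) (by fun_prop)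
    exact (d1.add ((d6.mul (d2.mul ((d4.mul d7).div_const _))).const_mul _)).add
      ((d3.mul ((d5.mul d8).div_const _)).const_mul _)
  · intro s hs hs2
    have m1 := (EEEE_conv hP hQ hα (s := s) (by linarith) hs2).1
    have hpsi := mellin_psi hs
    have hA := hasMellin_cv hP.1 psi_cont (hP.mellinConvergent (s := s) (by linarith)) hpsi.1
    have m2 : MellinConvergent (fun r => cv (Sw w) psi (α * r)) s :=
      (MellinConvergent.comp_mul_left hα).mpr hA.1
    have v2 : mellin (fun r => cv (Sw w) psi (α * r)) s = (α:ℂ) ^ (-s) * (mellin (Sw w) s *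
        (Complex.Gamma (s / 2) * riemannZeta s / 2)) := by
      rw [mellin_comp_mul_left _ _ hα, hA.2, smul_eq_mul, hpsi.2]
    have hE := mellin_EE (q := s - 1) (by simp; linarith) (by simp; linarith)
    have hB := hasMellin_cv hQ.1 EE_cont (hQ.mellinConvergent (s := s - 1) (by simp; linarith)) hE.1
    have m2' := m2.const_smul (1/2 * mellin (Qw w) 0)
    have m3' := (mellinConv_inv_mul hB.1).const_smul
      ((√Real.pi / 2 : ℂ) * (α:ℂ)⁻¹ * mellin (Sw w) 1)
    have k1 := hasMellin_add m1 m2'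
    have k2 := hasMellin_add k1.1 m3'
    rw [← v2, ← hE.2, ← hB.2, ← mellin_inv_mul, ← smul_eq_mul (1/2 * mellin (Qw w) 0),
      ← smul_eq_mul (_ * mellin (Sw w) 1),
      ← mellin_const_smul, ← mellin_const_smul, ← k1.2, ← k2.2]
    rw [mellin, mellin]
    refine setIntegral_congr_fun measurableSet_Ioi fun r hr => ?_
    simp only [smul_eq_mul]
    rw [cv_EE_eq hQ hr, cv_EE_eq hP (mul_pos hα hr), cv_psi_eq hQ hr, Complex.ofReal_mul, mul_inv]
    ring

theorem bracket_eq {w : ℂ} (hw : w ≠ 0) {z : ℂ} (hz1 : -1 < z.re) (hz2 : z.re < 1) (hz0 : z ≠ 0)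
    {α : ℝ} (hα : 0 < α) (F : ℂ → ℝ → ℂ)
    (hF : ∀ x : ℝ, 0 < x → DifferentiableOn ℂ (fun s => F s x) {s : ℂ | -1 < s.re ∧ s ≠ 1})
    (hFeq : ∀ x : ℝ, 0 < x → ∀ s : ℂ, 1 < s.re → F s x = zetaW w s (x + 1)) :
    ((∑' m : ℕ+, (F (z + 1) (m * α) + Afun w z * ((m * α : ℝ) : ℂ) ^ (-z - 1) / 2
          - Afun (I * w) (-z) * ((m * α : ℝ) : ℂ) ^ (-z) / z))
        - riemannZeta (z + 1) * Afun w z / (2 * (α:ℂ) ^ (z + 1))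
        - riemannZeta z * Afun w (-z) / (α * z)) =
    Cs w (z + 1) * mellin (fun r => cv (Sw w) EE (α * r) * cv (Qw w) EE r) (z + 1) := by
  have e : ∀ m : ℕ+, (F (z + 1) (m * α) + Afun w z * ((m * α : ℝ) : ℂ) ^ (-z - 1) / 2
          - Afun (I * w) (-z) * ((m * α : ℝ) : ℂ) ^ (-z) / z) =
      Cs w (z + 1) * mellin (fun r => cv (Sw w) gs ((m * α) * r) * cv (Qw w) TT r) (z + 1) := by
    intro m
    have hm : 0 < (m:ℝ) * α := mul_pos (pnat_pos m) hα
    exact phi_eq hw hm (fun s => F s (m * α)) (hF _ hm) (hFeq _ hm) hz1 hz2 hz0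
  have hx0 : (α:ℂ) ≠ 0 := by exact_mod_cast hα.ne'
  have hs : 0 < (z + 1).re := by simp; linarith
  rw [tsum_congr e, tsum_mul_left, sum_phi hα hs,
    psiTT_eq w hα hs (by simp; linarith) (by simpa using hz0)]
  have k1 := kummer 1 (w ^ 2 / 4)
  have k2 := kummer (1 - z / 2) (-(w ^ 2 / 4))
  rw [neg_neg, show 3/2 - (1 - z / 2) = (z + 1) / 2 by ring, Complex.exp_neg] at k2
  rw [show (3/2 - 1 : ℂ) = 1/2 by norm_num] at k1
  have he := Complex.exp_ne_zero (w ^ 2 / 4)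
  have k3 : oneF1 (1/2) (3/2) (-(w ^ 2 / 4)) * oneF1 (1 - z / 2) (3/2) (w ^ 2 / 4) =
      oneF1 1 (3/2) (w ^ 2 / 4) * oneF1 ((z + 1) / 2) (3/2) (-(w ^ 2 / 4)) := by
    have k4 := kummer (1/2) (w ^ 2 / 4)
    rw [show (3/2 - 1/2 : ℂ) = 1 by norm_num] at k4
    rw [← k2, ← k4]; field_simp
  rw [Afun_eq hw z, Afun_eq hw (-z), show 1 + -z / 2 = 1 - z / 2 by ring, k3, mellin_Qw_zero,
    mellin_Sw_one, mellin_Sw _ (by linarith), mellin_Qw _ (by simp; linarith), Cs]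
  rw [show (z + 1 + 1) / 2 = z / 2 + 1 by ring, show (z + 1 - 1) / 2 = z / 2 by ring,
    show z + 1 - 1 = z by ring, Complex.cpow_neg, Gamma_z_half hz0,
    show 1 + z / 2 = z / 2 + 1 by ring]
  have g1 := Gamma_z_ne2 hz1
  have g2 := Gamma_z_ne3 hz1 hz0
  have := sqrtpi_ne
  have h5 : (α:ℂ) ^ (z + 1) ≠ 0 := by simp [Complex.cpow_eq_zero_iff, hx0]
  field_simp
  ring

/-- derivative of the sinh kernel -/
def dSw (w : ℂ) (u : ℝ) : ℂ := w * (gs u * Complex.cosh (w * u)) - 2 * (u * Sw w u)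

lemma Sw_deriv (w : ℂ) (u : ℝ) : HasDerivAt (Sw w) (dSw w u) u := by
  have h1 : HasDerivAt (fun x : ℂ => Complex.exp (-x ^ 2) * Complex.sinh (w * x))
      (Complex.exp (-(u:ℂ) ^ 2) * (-(2 * (u:ℂ))) * Complex.sinh (w * u) +
        Complex.exp (-(u:ℂ) ^ 2) * (Complex.cosh (w * u) * w)) (u:ℂ) := by
    refine HasDerivAt.mul ?_ ?_
    · refine HasDerivAt.cexp ?_
      have := ((hasDerivAt_id (u:ℂ)).pow 2).neg
      refine (this.congr_deriv (by simp))
    · refine HasDerivAt.csinh ?_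
      simpa using (hasDerivAt_id (u:ℂ)).const_mul w
  have h2 := h1.comp_ofReal
  have e : (fun y : ℝ => Complex.exp (-(y:ℂ) ^ 2) * Complex.sinh (w * y)) = Sw w := by
    ext y; rw [Sw, gs]; try push_cast; try rfl
  rw [e] at h2
  convert h2 using 1
  rw [dSw, Sw, gs]; try push_cast
  ring

lemma norm_cosh_le_exp (x : ℂ) : ‖Complex.cosh x‖ ≤ Real.exp ‖x‖ := by
  rw [Complex.cosh, norm_div]
  have h1 := Complex.norm_exp_le_exp_norm x
  have h2 := Complex.norm_exp_le_exp_norm (-x)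
  rw [norm_neg] at h2
  have h3 := norm_add_le (Complex.exp x) (Complex.exp (-x))
  simp only [Complex.norm_ofNat]
  linarith

lemma gscosh_PB (w : ℂ) {a : ℝ} (ha : 0 ≤ a) :
    PB (fun u : ℝ => gs u * Complex.cosh (w * u)) a := by
  obtain ⟨C, hC, h⟩ := rpow_exp_bound (b := a) ha
  refine ⟨Real.exp ((‖w‖ + 1) ^ 2 / 4) * C, by positivity, fun y hy => ?_⟩
  rw [norm_mul, gs_norm]
  have h1 : ‖Complex.cosh (w * y)‖ ≤ Real.exp (‖w‖ * y) := by
    refine (norm_cosh_le_exp _).trans ?_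
    have : ‖w * (y:ℂ)‖ = ‖w‖ * y := by simp [abs_of_pos hy]
    rw [this]
  have h2 : Real.exp (-y ^ 2) * Real.exp (‖w‖ * y) ≤
      Real.exp ((‖w‖ + 1) ^ 2 / 4) * Real.exp (-y) := by
    rw [← Real.exp_add, ← Real.exp_add]
    apply Real.exp_le_exp.mpr
    nlinarith [sq_nonneg (y - (‖w‖ + 1) / 2)]
  have h3 := h y hy
  have h4 : Real.exp (-y) ≤ C * y ^ (-a) := by
    rw [Real.rpow_neg hy.le, ← div_eq_mul_inv, le_div_iff₀ (Real.rpow_pos_of_pos hy _)]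
    linarith
  calc Real.exp (-y ^ 2) * ‖Complex.cosh (w * y)‖
      ≤ Real.exp (-y ^ 2) * Real.exp (‖w‖ * y) := by gcongr
    _ ≤ (Real.exp ((‖w‖ + 1) ^ 2 / 4) * Real.exp (-y)) := h2
    _ ≤ Real.exp ((‖w‖ + 1) ^ 2 / 4) * (C * y ^ (-a)) := by gcongr
    _ = _ := by ring

lemma id_PB : PB (fun u : ℝ => (u:ℂ)) (-1) := 
  ⟨1, zero_le_one, fun y hy => by simp [abs_of_pos hy]⟩

lemma dSw_PB (w : ℂ) {a : ℝ} (ha : 0 ≤ a) : PB (dSw w) a := by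
  have h1 := (gscosh_PB w ha).const_mul w
  have h2 := ((id_PB.mul ((Sw_nice w).2 (a + 1) (by linarith)))).const_mul 2
  rw [show -1 + (a + 1) = a by ring] at h2
  exact h1.sub h2

lemma dSw_cont (w : ℂ) : Continuous (dSw w) := by
  have := gs_cont
  unfold dSw Sw
  fun_prop

lemma mellin_Sw_parts (w : ℂ) {p : ℂ} (hp : 0 < p.re) :
    p * mellin (Sw w) p = - mellin (dSw w) (p + 1) := by
  have hp0 : p ≠ 0 := by rintro rfl; simp at hp
  have c1 : MellinConvergent (dSw w) (p + 1) :=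
    PB.mellinConvergent (dSw_cont w).continuousOn (dSw_PB w (a := p.re + 2) (by linarith))
      (dSw_PB w le_rfl) (by rw [Complex.add_re, Complex.one_re]; linarith)
      (by rw [Complex.add_re, Complex.one_re]; linarith)
  have c2 : MellinConvergent (Sw w) p := (Sw_nice w).mellinConvergent (by linarith)
  have key : ∀ y : ℝ, 0 < y → ∀ b : ℝ, ∀ C : ℝ, ‖Sw w y‖ ≤ C * y ^ (-b) →
      ‖(y:ℂ) ^ p * Sw w y‖ ≤ C * y ^ (p.re - b) := by
    intro y hy b C h
    rw [norm_mul, norm_ofReal_cpow_pos hy, sub_eq_add_neg, Real.rpow_add hy]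
    calc y ^ p.re * ‖Sw w y‖ ≤ y ^ p.re * (C * y ^ (-b)) := by gcongr
      _ = _ := by ring
  have h := integral_Ioi_mul_deriv_eq_deriv_mul (a := (0:ℝ)) (u := fun u : ℝ => (u:ℂ) ^ p)
    (u' := fun u : ℝ => p * (u:ℂ) ^ (p - 1)) (v := Sw w) (v' := dSw w) (a' := 0) (b' := 0)
    (fun x hx => by
      exact hasDerivAt_ofReal_cpow_const (x := x) (ne_of_gt hx) (r := p) hp0)
    (fun x _ => Sw_deriv w x)
    (by
      have := c1
      rw [MellinConvergent] at this
      simp only [add_sub_cancel_right, smul_eq_mul] at this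
      exact this)
    (by
      refine IntegrableOn.congr_fun (c2.const_mul p) ?_ measurableSet_Ioi
      intro x _
      simp only [smul_eq_mul, Pi.mul_apply]; ring)
    (by
      obtain ⟨C, hC, h⟩ := (Sw_nice w).2 0 (by norm_num)
      refine squeeze_zero_norm' (a := fun y : ℝ => C * y ^ (p.re - 0)) ?_ ?_
      · filter_upwards [self_mem_nhdsWithin] with y hy
        exact key y hy 0 C (h y hy)
      · have : Tendsto (fun y : ℝ => C * y ^ (p.re - 0)) (𝓝 0) (𝓝 (C * 0 ^ (p.re - 0))) :=
          ((Real.continuousAt_rpow_const 0 (p.re - 0) (Or.inr (by linarith))).const_mul C)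
        rw [Real.zero_rpow (by linarith), mul_zero] at this
        exact this.mono_left nhdsWithin_le_nhds)
    (by
      obtain ⟨C, hC, h⟩ := (Sw_nice w).2 (p.re + 1) (by linarith)
      refine squeeze_zero_norm' (a := fun y : ℝ => C * y ^ (p.re - (p.re + 1))) ?_ ?_
      · filter_upwards [eventually_gt_atTop 0] with y hy
        exact key y hy _ C (h y hy)
      · rw [show p.re - (p.re + 1) = -1 by ring]
        simpa using (tendsto_rpow_neg_atTop (y := 1) one_pos).const_mul C)
  simp only [mul_assoc] at h
  rw [integral_const_mul] at h
  simp only [mellin, add_sub_cancel_right, smul_eq_mul]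
  rw [h]; ring

lemma mellin_norm_le (f : ℝ → ℂ) (p : ℂ) :
    ‖mellin f p‖ ≤ ∫ u in Ioi (0:ℝ), u ^ (p.re - 1) * ‖f u‖ := by
  rw [mellin]
  refine (norm_integral_le_integral_norm _).trans (le_of_eq ?_)
  refine setIntegral_congr_fun measurableSet_Ioi fun u hu => ?_
  simp only [norm_smul]
  rw [norm_ofReal_cpow_pos hu]; simp

lemma mellin_Sw_decay (w : ℂ) {c : ℝ} (hc : 0 < c) :
    ∃ C : ℝ, 0 ≤ C ∧ ∀ p : ℂ, p.re = c → ‖mellin (Sw w) p‖ ≤ C / ‖p‖ := by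
  refine ⟨∫ u in Ioi (0:ℝ), u ^ (c + 1 - 1) * ‖dSw w u‖, ?_, fun p hp => ?_⟩
  · exact setIntegral_nonneg measurableSet_Ioi fun u hu =>
      mul_nonneg (Real.rpow_nonneg (le_of_lt hu) _) (norm_nonneg _)
  · have hp0 : p ≠ 0 := by rintro rfl; simp at hp; linarith
    rw [le_div_iff₀ (norm_pos_iff.mpr hp0), mul_comm, ← norm_mul,
      mellin_Sw_parts w (by linarith), norm_neg]
    have := mellin_norm_le (dSw w) (p + 1)
    simpa [hp] using this

lemma mellin_Qw_decay (w : ℂ) {c : ℝ} (hc : 0 < c) :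
    ∃ C : ℝ, 0 ≤ C ∧ ∀ p : ℂ, p.re = c → ‖mellin (Qw w) p‖ ≤ C / ‖p‖ := by
  obtain ⟨C, hC, h⟩ := mellin_Sw_decay (I * w) hc
  refine ⟨C, hC, fun p hp => ?_⟩
  have e := mellin_const_smul (Sw (I * w)) p (-I)
  simp only [smul_eq_mul] at e
  rw [Qw_eq, e, norm_mul, norm_neg, Complex.norm_I, one_mul]
  exact h p hp

/-- product of the four Mellin transforms -/
def MM (w s p : ℂ) : ℂ :=
  (mellin (Qw w) (s - p) * mellin EE (s - p)) * (mellin (Sw w) p * mellin EE p)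

lemma EE_diff {p : ℂ} (h0 : 0 < p.re) (h1 : p.re < 1) : DifferentiableAt ℂ (mellin EE) p :=
  PB.mellinDiff EE_cont EE_PB1 EE_PB0 h0 h1

lemma MM_diff (w : ℂ) {s p : ℂ} (h0 : 0 < p.re) (h1 : p.re < 1) (h2 : 0 < (s - p).re)
    (h3 : (s - p).re < 1) : DifferentiableAt ℂ (MM w s) p := by
  have d1 : DifferentiableAt ℂ (fun p => mellin (Qw w) (s - p)) p :=
    DifferentiableAt.comp (g := mellin (Qw w)) (f := fun p => s - p) p
      ((Qw_nice w).mellinDiff (by linarith)) (by fun_prop)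
  have d2 : DifferentiableAt ℂ (fun p => mellin EE (s - p)) p :=
    DifferentiableAt.comp (g := mellin EE) (f := fun p => s - p) p
      (EE_diff h2 h3) (by fun_prop)
  exact (d1.mul d2).mul (((Sw_nice w).mellinDiff (by linarith)).mul (EE_diff h0 h1))

lemma MM_vert (w : ℂ) {s : ℂ} (h0 : 0 < s.re) (h2 : s.re < 2) :
    Complex.VerticalIntegrable (MM w s) (s.re / 2) := by
  set c := s.re / 2 with hc
  have hc0 : 0 < c := by rw [hc]; linarith
  have hc1 : c < 1 := by rw [hc]; linarith
  obtain ⟨C1, hC1, b1⟩ := mellin_Sw_decay w hc0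
  obtain ⟨C2, hC2, b2⟩ := mellin_Qw_decay w hc0
  set K := ∫ u in Ioi (0:ℝ), u ^ (c - 1) * ‖EE u‖ with hK
  have hK0 : 0 ≤ K := setIntegral_nonneg measurableSet_Ioi fun u hu =>
      mul_nonneg (Real.rpow_nonneg (le_of_lt hu) _) (norm_nonneg _)
  have bE : ∀ p : ℂ, p.re = c → ‖mellin EE p‖ ≤ K := fun p hp => by
    have := mellin_norm_le EE p
    rwa [hp] at this
  have re1 : ∀ y : ℝ, ((c:ℂ) + y * I).re = c := fun y => by simp
  have re2 : ∀ y : ℝ, (s - ((c:ℂ) + y * I)).re = c := fun y => by simp [hc]; ring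
  rw [Complex.VerticalIntegrable]
  have hcont : Continuous (fun y : ℝ => MM w s ((c:ℂ) + y * I)) := by
    rw [continuous_iff_continuousAt]
    intro y
    refine ContinuousAt.comp (g := MM w s) (f := fun y : ℝ => (c:ℂ) + y * I) ?_ (by fun_prop)
    exact (MM_diff w (by rw [re1]; exact hc0) (by rw [re1]; exact hc1) (by rw [re2]; exact hc0)
      (by rw [re2]; exact hc1)).continuousAt
  have low : ∀ (p : ℂ), p.re = c → c ^ 2 + p.im ^ 2 = ‖p‖ ^ 2 := fun p hp => by
    rw [← hp, Complex.sq_norm, Complex.normSq_apply]; ring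
  have i1 : ∀ d : ℝ, Integrable (fun y : ℝ => (c ^ 2 + (y - d) ^ 2)⁻¹) := by
    intro d
    have h1 : Integrable (fun y : ℝ => (1 + (c⁻¹ * y) ^ 2)⁻¹) := 
      (integrable_inv_one_add_sq).comp_mul_left' (inv_ne_zero hc0.ne')
    have h2 : Integrable (fun y : ℝ => (c ^ 2 + y ^ 2)⁻¹) := by
      refine (h1.const_mul ((c^2)⁻¹)).congr (Eventually.of_forall fun y => ?_)
      simp only
      rw [← mul_inv]; congr 1; field_simp
    exact h2.comp_sub_right d
  have i2 := (((i1 0).add (i1 s.im)).const_mul (C2 * K * (C1 * K)))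
  refine i2.mono' hcont.aestronglyMeasurable (Eventually.of_forall fun y => ?_)
  set p : ℂ := (c:ℂ) + y * I with hp
  have r1 : p.re = c := re1 y
  have r2 : (s - p).re = c := re2 y
  have l1 := low p r1
  have l2 := low _ r2
  have im1 : p.im = y := by simp [hp]
  have im2 : (s - p).im = s.im - y := by simp [hp]
  rw [im1] at l1
  rw [im2] at l2
  have n1 : 0 < ‖p‖ := norm_pos_iff.mpr (by intro h; rw [h] at r1; simp at r1; linarith)
  have n2 : 0 < ‖s - p‖ := norm_pos_iff.mpr (by intro h; rw [h] at r2; simp at r2; linarith)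
  rw [MM, norm_mul, norm_mul, norm_mul]
  have q1 := b1 p r1
  have q2 := b2 _ r2
  have q3 := bE p r1
  have q4 := bE _ r2
  have amgm : (‖s - p‖)⁻¹ * (‖p‖)⁻¹ ≤ (‖p‖ ^ 2)⁻¹ + (‖s - p‖ ^ 2)⁻¹ := by
    rw [← inv_pow, ← inv_pow]
    nlinarith [sq_nonneg (‖p‖⁻¹ - ‖s - p‖⁻¹), sq_nonneg (‖p‖⁻¹), sq_nonneg (‖s - p‖⁻¹)]
  calc ‖mellin (Qw w) (s - p)‖ * ‖mellin EE (s - p)‖ * (‖mellin (Sw w) p‖ * ‖mellin EE p‖)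
      ≤ ((C2 / ‖s - p‖) * K) * ((C1 / ‖p‖) * K) := by gcongr
    _ = (C2 * K * (C1 * K)) * ((‖s - p‖)⁻¹ * (‖p‖)⁻¹) := by rw [div_eq_mul_inv, div_eq_mul_inv]; ring
    _ ≤ (C2 * K * (C1 * K)) * ((‖p‖ ^ 2)⁻¹ + (‖s - p‖ ^ 2)⁻¹) := by gcongr
    _ = _ := by
      rw [← l1, ← l2]
      simp only [Pi.add_apply, sub_zero]
      rw [show (s.im - y) ^ 2 = (y - s.im) ^ 2 by ring]

lemma mellinConv_comp_inv {f : ℝ → ℂ} {p : ℂ} (h : MellinConvergent f (-p)) :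
    MellinConvergent (fun u => f u⁻¹) p := by
  have := (MellinConvergent.comp_rpow (f := f) (s := p) (a := -1) (by norm_num)).mpr (by
    simpa [div_neg] using h)
  simpa only [Real.rpow_neg_one] using this

/-- reflected kernel -/
def rk (B : ℝ → ℂ) (s : ℂ) (u : ℝ) : ℂ := (u:ℂ) ^ (-s) * B u⁻¹

lemma rk_cont {B : ℝ → ℂ} (hB : ContinuousOn B (Ioi 0)) (s : ℂ) : ContinuousOn (rk B s) (Ioi 0) := by
  refine (cpow_contOn (-s)).mul (hB.comp (continuousOn_inv₀.mono ?_) ?_)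
  · intro u hu; exact ne_of_gt hu
  · intro u hu; exact inv_pos.mpr (show (0:ℝ) < u from hu)

lemma rk_mellin {B : ℝ → ℂ} {s p : ℂ} (h : MellinConvergent B (s - p)) :
    HasMellin (rk B s) p (mellin B (s - p)) := by
  constructor
  · have := (MellinConvergent.cpow_smul (f := fun u => B u⁻¹) (s := p) (a := -s)).mpr
      (mellinConv_comp_inv (by rw [show -(p + -s) = s - p by ring]; exact h))
    exact this
  · have := mellin_cpow_smul (fun u => B u⁻¹) p (-s)
    rw [mellin_comp_inv, show -(p + -s) = s - p by ring] at this
    exact this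

lemma mellin_eq_cv (A B : ℝ → ℂ) (s : ℂ) (α : ℝ) :
    mellin (fun r => A (α * r) * B r) s = cv (rk B s) A α := by
  have h := mellin_comp_inv (fun r : ℝ => (r:ℂ) ^ s • (A (α * r) * B r)) 0
  rw [mellin_cpow_smul, neg_zero, zero_add] at h
  rw [← h, mellin, cv]
  refine setIntegral_congr_fun measurableSet_Ioi fun u hu => ?_
  have hu' : (0:ℝ) < u := hu
  simp only [rk, smul_eq_mul]
  rw [zero_sub, Complex.cpow_neg_one, Complex.ofReal_inv, Complex.inv_cpow _ _ ?_, Complex.cpow_neg,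
    div_eq_mul_inv α u]
  · ring
  · rw [Complex.arg_ofReal_of_nonneg hu'.le]; exact Real.pi_pos.ne

lemma cv_continuousAt {f N : ℝ → ℂ} {c : ℝ} (hfc : ContinuousOn f (Ioi 0)) (hc : 0 ≤ c)
    (hf : MellinConvergent f c)
    (hNc : ContinuousOn N (Ioi 0)) (hN : PB N c) {r0 : ℝ} (hr0 : 0 < r0) :
    ContinuousAt (cv f N) r0 := by
  obtain ⟨C, hC, hN⟩ := hN
  refine continuousAt_of_dominated
    (bound := fun u => (C * (r0 / 2) ^ (-c)) * (u ^ (c - 1) * ‖f u‖)) ?_ ?_ ?_ ?_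
  · filter_upwards [Ioi_mem_nhds hr0] with r hr
    exact (cv_contOn_integrand hfc hNc hr).aestronglyMeasurable measurableSet_Ioi
  · filter_upwards [Ioi_mem_nhds (half_lt_self hr0)] with r hr
    have hr1 : r0 / 2 < r := hr
    have hr2 : 0 < r := by linarith
    filter_upwards [ae_restrict_mem measurableSet_Ioi] with u hu
    have hu' : (0:ℝ) < u := hu
    refine (cv_dom (f := f) hN hr2 hu).trans ?_
    have : r ^ (-c) ≤ (r0 / 2) ^ (-c) :=
      Real.rpow_le_rpow_of_nonpos (by positivity) hr1.le (by linarith)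
    gcongr
  · have := hf.norm'
    rw [Complex.ofReal_re] at this
    exact this.const_mul _
  · filter_upwards [ae_restrict_mem measurableSet_Ioi] with u hu
    refine ContinuousAt.div_const (continuousAt_const.mul ?_) _
    have h : ContinuousAt N (r0 / u) := hNc.continuousAt (Ioi_mem_nhds (div_pos hr0 hu))
    exact ContinuousAt.comp (f := fun r : ℝ => r / u) h (by fun_prop)

lemma cvEE_mellin {f : ℝ → ℂ} (hf : Nice f) {p : ℂ} (h0 : 0 < p.re) (h1 : p.re < 1) :
    HasMellin (cv f EE) p (mellin f p * mellin EE p) :=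
  hasMellin_cv hf.1 EE_cont (hf.mellinConvergent (by linarith)) (mellin_EE h0 h1).1

theorem G_inv (w : ℂ) {s : ℂ} (h0 : 0 < s.re) (h2 : s.re < 2) {α : ℝ} (hα : 0 < α) :
    mellin (fun r => cv (Sw w) EE (α * r) * cv (Qw w) EE r) s =
      mellinInv (s.re / 2) (MM w s) α := by
  have hP := Sw_nice w
  have hQ := Qw_nice w
  set c := s.re / 2 with hc
  have hc0 : 0 < c := by rw [hc]; linarith
  have hc1 : c < 1 := by rw [hc]; linarith
  rw [mellin_eq_cv]
  have hM : ∀ p : ℂ, p.re = c → HasMellin (cv (rk (cv (Qw w) EE) s) (cv (Sw w) EE)) p (MM w s p) := by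
    intro p hp
    have r2 : (s - p).re = c := by simp [hp, hc]; ring
    have hB := cvEE_mellin hQ (p := s - p) (by linarith) (by linarith)
    have hA := cvEE_mellin hP (p := p) (by linarith) (by linarith)
    have hk := rk_mellin hB.1
    have := hasMellin_cv (rk_cont (EEcv_cont hQ) s) (EEcv_cont hP) hk.1 hA.1
    rw [hk.2, hB.2, hA.2] at this
    exact this
  have e : ∀ y : ℝ, mellin (cv (rk (cv (Qw w) EE) s) (cv (Sw w) EE)) ((c:ℂ) + y * I) =
      MM w s ((c:ℂ) + y * I) := fun y => (hM _ (by simp)).2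
  have hcc : ((c:ℝ):ℂ).re = c := Complex.ofReal_re c
  have hinv := mellinInv_mellin_eq c (cv (rk (cv (Qw w) EE) s) (cv (Sw w) EE)) hα
    (hM _ hcc).1 (by
      have := MM_vert w h0 h2
      rw [Complex.VerticalIntegrable] at this ⊢
      simpa only [e] using this)
    (cv_continuousAt (c := c) (rk_cont (EEcv_cont hQ) s) hc0.le
      (rk_mellin (cvEE_mellin hQ (p := s - (c:ℂ)) (by simp [hc]; linarith) (by simp [hc]; linarith)).1).1
      (EEcv_cont hP) (EEcv_PB hP hc0.le hc1.le) hα)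
  rw [← hinv, mellinInv, mellinInv]
  simp only [e]

/-- product of gamma and zeta factors -/
def Xf (s p : ℂ) : ℂ :=
  Complex.Gamma (p / 2) * Complex.Gamma ((p + 1) / 2) * riemannZeta p *
    (Complex.Gamma ((s - p) / 2) * Complex.Gamma ((s - p + 1) / 2) * riemannZeta (s - p))

lemma Xf_symm (s p : ℂ) : Xf s (s - p) = Xf s p := by
  rw [Xf, Xf, sub_sub_cancel]; ring

lemma MM_eq (w : ℂ) {s p : ℂ} (h0 : 0 < p.re) (h1 : p.re < 1) (h2 : 0 < (s - p).re)
    (h3 : (s - p).re < 1) :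
    MM w s p = w ^ 2 / 16 * Xf s p * (oneF1 ((p + 1) / 2) (3/2) (w ^ 2 / 4) *
      oneF1 ((s - p + 1) / 2) (3/2) (-(w ^ 2 / 4))) := by
  rw [MM, mellin_Qw _ (by linarith), mellin_Sw _ (by linarith), (mellin_EE h0 h1).2,
    (mellin_EE h2 h3).2, Xf]
  ring

lemma omega_eq (α : ℝ) (z w t : ℂ) :
    omegaFun α (z / 2) w ((1 + I * t) / 2) = (α:ℂ) ^ (-(I * t) / 2) *
      (oneF1 (((1 + z + I * t) / 2 + 1) / 2) (3/2) (w ^ 2 / 4) *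
      oneF1 ((z + 1 - (1 + z + I * t) / 2 + 1) / 2) (3/2) (-(w ^ 2 / 4))) := by
  have k := kummer (1 - ((1 + z + I * t) / 2) / 2) (w ^ 2 / 4)
  rw [show 3/2 - (1 - ((1 + z + I * t) / 2) / 2) = ((1 + z + I * t) / 2 + 1) / 2 by ring] at k
  rw [omegaFun, ← k, show -w ^ 2 / 4 = -(w ^ 2 / 4) by ring,
    show (1:ℂ) / 2 - (1 + I * t) / 2 = -(I * t) / 2 by ring,
    show 1 - ((1 + I * t) / 2 + z / 2) / 2 = 1 - ((1 + z + I * t) / 2) / 2 by ring,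
    show 1 - ((1 + I * t) / 2 - z / 2) / 2 = (z + 1 - (1 + z + I * t) / 2 + 1) / 2 by ring]
  ring

lemma xi_eq {q : ℂ} (h0 : 0 < q.re) :
    RiemannXi q = 1/2 * q * (q - 1) * completedRiemannZeta q := by
  have hq : q ≠ 0 := by rintro rfl; simp at h0
  have hG : Complex.Gammaℝ q ≠ 0 := Complex.Gammaℝ_ne_zero_of_re_pos h0
  have h := riemannZeta_def_of_ne_zero hq
  rw [eq_div_iff hG, Complex.Gammaℝ_def] at h
  rw [RiemannXi, ← h]; ring

lemma xi_symm {q : ℂ} (h0 : 0 < q.re) (h1 : q.re < 1) : RiemannXi (1 - q) = RiemannXi q := by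
  rw [xi_eq h0, xi_eq (by simp; linarith), completedRiemannZeta_one_sub]; ring

lemma Gamma_xi {p : ℂ} (h1 : p.re < 1) :
    Complex.Gamma ((p - 1) / 2) * RiemannXi p =
      p * (Real.pi : ℂ) ^ (-p / 2) * (Complex.Gamma (p / 2) * Complex.Gamma ((p + 1) / 2) * riemannZeta p) := by
  have hp : (p - 1) / 2 ≠ 0 := by
    intro h
    have : p = 1 := by linear_combination 2 * h
    rw [this] at h1; simp at h1
  have := Complex.Gamma_add_one _ hp
  rw [show (p - 1) / 2 + 1 = (p + 1) / 2 by ring] at this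
  rw [this, RiemannXi]; ring

lemma integrand_eq {w z : ℂ} (hz1 : -1 < z.re) (hz2 : z.re < 1) (α : ℝ) (t : ℝ) :
    Complex.Gamma ((z - 1 + I * t) / 4) * Complex.Gamma ((z - 1 - I * t) / 4) *
          RiemannBigXi ((t + I * z) / 2) * RiemannBigXi ((t - I * z) / 2) *
          Delta2 α (z / 2) w ((1 + I * t) / 2) / ((z + 1) ^ 2 + (t:ℂ) ^ 2) =
    1/4 * (Real.pi : ℂ) ^ (-(z + 1) / 2) * (Xf (z + 1) ((1 + z + I * t) / 2) *
      Delta2 α (z / 2) w ((1 + I * t) / 2)) := by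
  set p : ℂ := (1 + z + I * t) / 2 with hp
  set q : ℂ := z + 1 - p with hq
  have rp : p.re = (1 + z.re) / 2 := by simp [hp]
  have rq : q.re = (1 + z.re) / 2 := by rw [hq]; simp [rp]; ring
  have hp0 : p ≠ 0 := by intro h; rw [h] at rp; simp at rp; linarith
  have hq0 : q ≠ 0 := by intro h; rw [h] at rq; simp at rq; linarith
  have e1 : RiemannBigXi ((t + I * z) / 2) = RiemannXi q := by
    rw [← xi_symm (by linarith) (by linarith), RiemannBigXi]
    congr 1
    rw [hq, hp]; linear_combination (z / 2) * Complex.I_mul_I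
  have e2 : RiemannBigXi ((t - I * z) / 2) = RiemannXi p := by
    rw [RiemannBigXi]
    congr 1
    rw [hp]; linear_combination (-z / 2) * Complex.I_mul_I
  have e3 : (z + 1) ^ 2 + (t:ℂ) ^ 2 = 4 * (p * q) := by
    rw [hq, hp]; linear_combination (t:ℂ) ^ 2 * Complex.I_mul_I
  have g1 := Gamma_xi (p := p) (by linarith)
  have g2 := Gamma_xi (p := q) (by linarith)
  have hpi : (Real.pi : ℂ) ≠ 0 := by exact_mod_cast Real.pi_ne_zero
  have e4 : (Real.pi : ℂ) ^ (-(z + 1) / 2) = (Real.pi : ℂ) ^ (-p / 2) * (Real.pi : ℂ) ^ (-q / 2) := by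
    rw [← Complex.cpow_add _ _ hpi]; congr 1; rw [hq]; ring
  rw [e1, e2, e3, e4, show (z - 1 + I * t) / 4 = (p - 1) / 2 by rw [hp]; ring,
    show (z - 1 - I * t) / 4 = (q - 1) / 2 by rw [hq, hp]; ring]
  rw [div_eq_iff (by simp [hp0, hq0]), Xf, ← hq]
  linear_combination (Complex.Gamma ((q - 1) / 2) * RiemannXi q *
      Delta2 α (z / 2) w ((1 + I * t) / 2)) * g1 +
    (p * (Real.pi : ℂ) ^ (-p / 2) * (Complex.Gamma (p / 2) * Complex.Gamma ((p + 1) / 2) * riemannZeta p) *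
      Delta2 α (z / 2) w ((1 + I * t) / 2)) * g2

lemma fold {h : ℝ → ℂ} (hi : Integrable h) :
    ∫ t, h t = ∫ t in Ioi (0:ℝ), (h t + h (-t)) := by
  rw [integral_add hi.integrableOn (hi.comp_neg.integrableOn), integral_comp_neg_Ioi,
    neg_zero, add_comm, intervalIntegral.integral_Iic_add_Ioi hi.integrableOn hi.integrableOn]

theorem inv_eq {w : ℂ} (hw : w ≠ 0) {z : ℂ} (hz1 : -1 < z.re) (hz2 : z.re < 1) {α : ℝ} (hα : 0 < α) :
    (α:ℂ) ^ ((z + 1) / 2) * mellinInv ((z + 1).re / 2) (MM w (z + 1)) α =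
      w ^ 2 / (64 * Real.pi) * ∫ t in Ioi (0:ℝ), Xf (z + 1) ((1 + z + I * t) / 2) *
      Delta2 α (z / 2) w ((1 + I * t) / 2) := by
  have hα0 : (α:ℂ) ≠ 0 := by exact_mod_cast hα.ne'
  set c := (z + 1).re / 2 with hc
  have hc' : c = (1 + z.re) / 2 := by rw [hc]; simp; ring
  have hv := MM_vert w (s := z + 1) (by simp; linarith) (by simp; linarith)
  rw [Complex.VerticalIntegrable, ← hc] at hv
  set g : ℝ → ℂ := fun y => (α:ℂ) ^ ((z + 1) / 2) * ((α:ℂ) ^ (-((c:ℂ) + y * I)) * MM w (z + 1) ((c:ℂ) + y * I)) with hg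
  set h : ℝ → ℂ := fun t => Xf (z + 1) ((1 + z + I * t) / 2) * omegaFun α (z / 2) w ((1 + I * t) / 2) with hh
  have hgi : Integrable g := by
    refine Integrable.const_mul ?_ _
    refine Integrable.bdd_mul (c := α ^ (-c)) hv ?_ (Eventually.of_forall fun y => ?_)
    · refine Continuous.aestronglyMeasurable ?_
      exact Continuous.const_cpow (by fun_prop) (Or.inl hα0)
    · rw [norm_ofReal_cpow_pos hα]; simp
  have hgh : ∀ t : ℝ, g ((t + z.im) / 2) = w ^ 2 / 16 * h t := by
    intro t
    have ep : (c:ℂ) + (((t + z.im) / 2 : ℝ):ℂ) * I = (1 + z + I * t) / 2 := by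
      rw [hc']; push_cast
      linear_combination (1/2) * Complex.re_add_im z
    have rp : ((1 + z + I * t) / 2).re = (1 + z.re) / 2 := by simp
    have rq : (z + 1 - (1 + z + I * t) / 2).re = (1 + z.re) / 2 := by
      rw [Complex.sub_re, rp]; simp; ring
    simp only [hg, hh]
    rw [ep, MM_eq w (by linarith) (by linarith) (by linarith) (by linarith), omega_eq,
      show -(I * (t:ℂ)) / 2 = (z + 1) / 2 + (-((1 + z + I * t) / 2)) by ring, Complex.cpow_add _ _ hα0]
    ring
  have hsub : ∫ y, g y = (1/2) * ∫ t : ℝ, g ((t + z.im) / 2) := by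
    rw [integral_add_right_eq_self (fun t => g (t / 2)), Measure.integral_comp_div]
    simp
  have hhi : Integrable h := by
    have h1 : Integrable (fun t : ℝ => g ((t + z.im) / 2)) :=
      (hgi.comp_div (two_ne_zero)).comp_add_right z.im
    refine (h1.const_mul (16 / w ^ 2)).congr (Eventually.of_forall fun t => ?_)
    simp only [hgh]
    field_simp
  have hfold : ∫ t in Ioi (0:ℝ), Xf (z + 1) ((1 + z + I * t) / 2) *
      Delta2 α (z / 2) w ((1 + I * t) / 2) = ∫ t, h t := by
    rw [fold hhi]
    congr 1; ext t
    simp only [hh]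
    rw [← Xf_symm _ ((1 + z + I * t) / 2), Delta2]
    push_cast
    rw [show z + 1 - (1 + z + I * t) / 2 = (1 + z + I * -t) / 2 by ring,
      show 1 - (1 + I * (t:ℂ)) / 2 = (1 + I * -t) / 2 by ring,
      ← Xf_symm _ ((1 + z + I * -t) / 2),
      show z + 1 - (1 + z + I * -t) / 2 = (1 + z + I * (t:ℂ)) / 2 by ring]
    ring
  rw [hfold, mellinInv, ← smul_eq_mul ((α:ℂ) ^ _), smul_comm, smul_eq_mul, ← integral_const_mul]
  simp only [smul_eq_mul]
  have : ∫ a : ℝ, (α:ℂ) ^ ((z + 1) / 2) * ((α:ℂ) ^ (-((c:ℂ) + a * I)) * MM w (z + 1) ((c:ℂ) + a * I)) = ∫ y, g y := rfl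
  rw [this, hsub]
  simp only [hgh]
  rw [integral_const_mul, Complex.real_smul]
  push_cast
  field_simp
  ring

/-- Integral representation in the generalized modular relation (second equality of
Theorem 2.1 / Theorems 1.1.5–1.1.6 of Dixit–Kumar), stated for any analytic continuation
`F` of `ζ_w(·, x+1)`. -/
theorem generalized_modular_integral (w : ℂ) (hw : w ≠ 0)
    (z : ℂ) (hz1 : -1 < z.re) (hz2 : z.re < 1) (hz0 : z ≠ 0)
    (α : ℝ) (hα : 0 < α)
    (F : ℂ → ℝ → ℂ)
    (hF : ∀ x : ℝ, 0 < x → DifferentiableOn ℂ (fun s => F s x) {s : ℂ | -1 < s.re ∧ s ≠ 1})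
    (hFeq : ∀ x : ℝ, 0 < x → ∀ s : ℂ, 1 < s.re → F s x = zetaW w s (x + 1)) :
    (α:ℂ) ^ ((z + 1) / 2) *
      ((∑' m : ℕ+, (F (z + 1) (m * α) + Afun w z * ((m * α : ℝ) : ℂ) ^ (-z - 1) / 2
          - Afun (I * w) (-z) * ((m * α : ℝ) : ℂ) ^ (-z) / z))
        - riemannZeta (z + 1) * Afun w z / (2 * (α:ℂ) ^ (z + 1))
        - riemannZeta z * Afun w (-z) / (α * z))
  = ((2:ℂ) ^ (z - 1) * (Real.pi : ℂ) ^ ((z - 3) / 2) / Complex.Gamma (z + 1)) *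
      ∫ t in Ioi (0:ℝ),
        Complex.Gamma ((z - 1 + I * t) / 4) * Complex.Gamma ((z - 1 - I * t) / 4) *
          RiemannBigXi ((t + I * z) / 2) * RiemannBigXi ((t - I * z) / 2) *
          Delta2 α (z / 2) w ((1 + I * t) / 2) / ((z + 1) ^ 2 + (t:ℂ) ^ 2) := by
  rw [bracket_eq hw hz1 hz2 hz0 hα F hF hFeq, G_inv w (by simp; linarith) (by simp; linarith) hα]
  have hIntg : (∫ t in Ioi (0:ℝ),
        Complex.Gamma ((z - 1 + I * t) / 4) * Complex.Gamma ((z - 1 - I * t) / 4) *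
          RiemannBigXi ((t + I * z) / 2) * RiemannBigXi ((t - I * z) / 2) *
          Delta2 α (z / 2) w ((1 + I * t) / 2) / ((z + 1) ^ 2 + (t:ℂ) ^ 2)) =
      1/4 * (Real.pi : ℂ) ^ (-(z + 1) / 2) * ∫ t in Ioi (0:ℝ), Xf (z + 1) ((1 + z + I * t) / 2) *
      Delta2 α (z / 2) w ((1 + I * t) / 2) := by
    rw [← integral_const_mul]
    congr 1; ext t
    exact integrand_eq hz1 hz2 α t
  rw [hIntg, mul_left_comm, inv_eq hw hz1 hz2 hα, Cs]
  have hL := Complex.Gamma_mul_Gamma_add_half ((z + 1) / 2)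
  rw [show (z + 1) / 2 + 1 / 2 = (z + 1 + 1) / 2 by ring, show 2 * ((z + 1) / 2) = z + 1 by ring] at hL
  have hpi : (Real.pi : ℂ) ≠ 0 := by exact_mod_cast Real.pi_ne_zero
  have g0 : Complex.Gamma (z + 1) ≠ 0 := Complex.Gamma_ne_zero_of_re_pos (by simp; linarith)
  have hinv : (Complex.Gamma ((z + 1 + 1) / 2))⁻¹ * (Complex.Gamma ((z + 1) / 2))⁻¹ =
      (2:ℂ) ^ z / (Complex.Gamma (z + 1) * ((√Real.pi : ℝ) : ℂ)) := by
    rw [← mul_inv, mul_comm (Complex.Gamma ((z + 1 + 1) / 2)), hL,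
      show 1 - (z + 1) = -z by ring, Complex.cpow_neg, mul_inv, mul_inv, inv_inv]
    field_simp
  have hsq : ((√Real.pi : ℝ) : ℂ) * ((√Real.pi : ℝ) : ℂ) = (Real.pi : ℂ) := by
    rw [← Complex.ofReal_mul, Real.mul_self_sqrt Real.pi_pos.le]
  have hp2 : (Real.pi : ℂ) ^ ((z - 3) / 2) * (Real.pi : ℂ) ^ (-(z + 1) / 2) = ((Real.pi : ℂ) ^ 2)⁻¹ := by
    rw [← Complex.cpow_add _ _ hpi, show (z - 3) / 2 + -(z + 1) / 2 = -((2 : ℕ) : ℂ) by push_cast; ring,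
      Complex.cpow_neg, Complex.cpow_natCast]
  have h2 : (2:ℂ) ^ (z - 1) = (2:ℂ) ^ z / 2 := by
    rw [Complex.cpow_sub _ _ two_ne_zero, Complex.cpow_one]
  have hs0 := sqrtpi_ne
  rw [hinv, h2]
  set J := ∫ t in Ioi (0:ℝ), Xf (z + 1) ((1 + z + I * t) / 2) *
      Delta2 α (z / 2) w ((1 + I * t) / 2)
  calc _ = (1 / 8) * (2:ℂ) ^ z / (Complex.Gamma (z + 1) *
        (((√Real.pi : ℝ) : ℂ) * ((√Real.pi : ℝ) : ℂ)) * Real.pi) * J := by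
        field_simp; ring
    _ = (1 / 8) * (2:ℂ) ^ z / Complex.Gamma (z + 1) * ((Real.pi : ℂ) ^ 2)⁻¹ * J := by
        rw [hsq]; field_simp
    _ = _ := by rw [← hp2]; ring
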